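/- arXiv:1212.6860 — 2 statements merged into one kernel-verified Lean document; each statement's English description precedes it below -/
import Mathlib

section
/- Let Σ be a class of commutative rings (closed under ring isomorphism) and let n be a natural number, such that: (i) whenever R ∈ Σ and f ∈ R[Y] is a nonzero non-unit polynomial in one variable, the localization of R[Y] at the multiplicative set generated by f and 1 + fR[Y] again belongs to Σ; and (ii) whenever R ∈ Σ, every finitely generated projective module over the polynomial ring R[Y_1,…,Y_n] is free. Then for every R ∈ Σ, every natural number m ≤ n and polynomials f_1 ∈ R[Y_1], …, f_m ∈ R[Y_m], every finitely generated projective module over A = R[Y_1,…,Y_n][(f_1⋯f_m)^{-1}] is free. -/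
open Polynomial


/-- The ring `R[Y₁,…,Yₙ][(f₁⋯f_m)⁻¹]`: the localization of the polynomial ring
`R[Y₁,…,Yₙ]` away from the product `f₁⋯f_m`, where each `fᵢ ∈ R[Yᵢ]`. -/
abbrev LocalizedPolynomialRing (R : Type*) [CommRing R] (n m : ℕ) (hmn : m ≤ n)
    (f : Fin m → Polynomial R) : Type _ :=
  Localization.Away
    (∏ i : Fin m, Polynomial.aeval (MvPolynomial.X (Fin.castLE hmn i)) (f i) :
      MvPolynomial (Fin n) R)

universe u

/-- All finitely generated projective modules are free. -/
def AllFree (A : Type u) [CommRing A] : Prop :=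
  ∀ (P : Type u) [AddCommGroup P] [Module A P], Module.Finite A P → Module.Projective A P →
    Module.Free A P

open TensorProduct in
lemma AllFree.tower {D E : Type u} [CommRing D] [CommRing E] [Algebra D E] [Algebra E D]
    [IsScalarTower D E D] (h : AllFree E) : AllFree D := by
  intro P _ _ hf hp
  have : Module.Free E (E ⊗[D] P) := h _ inferInstance inferInstance
  have h2 : Module.Free D (D ⊗[E] (E ⊗[D] P)) := inferInstance
  exact Module.Free.of_equiv ((TensorProduct.AlgebraTensorModule.cancelBaseChange D E D D P).trans
    (TensorProduct.lid D P))

lemma AllFree.retract {D E : Type u} [CommRing D] [CommRing E] (h : AllFree E)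
    (i : D →+* E) (p : E →+* D) (hpi : p.comp i = RingHom.id D) : AllFree D := by
  let := i.toAlgebra
  let := p.toAlgebra
  have : IsScalarTower D E D := IsScalarTower.of_algebraMap_eq fun x => (RingHom.congr_fun hpi x).symm
  exact h.tower

/-- The fibre product of `φ` and `ψ`. -/
abbrev FibreProd {B P N L : Type*} [CommRing B] [AddCommGroup P] [AddCommGroup N] [AddCommGroup L]
    [Module B P] [Module B N] [Module B L] (φ : P →ₗ[B] L) (ψ : N →ₗ[B] L) :
    Submodule B (P × N) :=
  LinearMap.eqLocus (φ ∘ₗ LinearMap.fst B P N) (ψ ∘ₗ LinearMap.snd B P N)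

section fp
variable {B P N L : Type*} [CommRing B] [AddCommGroup P] [AddCommGroup N] [AddCommGroup L]
    [Module B P] [Module B N] [Module B L] (φ : P →ₗ[B] L) (ψ : N →ₗ[B] L)

lemma fst_loc (S : Submonoid B) [IsLocalizedModule S ψ]
    (hP : ∀ x : S, IsUnit (algebraMap B (Module.End B P) x)) :
    IsLocalizedModule S (LinearMap.fst B P N ∘ₗ (FibreProd φ ψ).subtype) where
  map_units := hP
  surj y := by
    obtain ⟨⟨v, s⟩, h⟩ := IsLocalizedModule.surj S ψ (φ y)
    refine ⟨⟨⟨(s • y, v), ?_⟩, s⟩, rfl⟩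
    simp only [LinearMap.mem_eqLocus, LinearMap.comp_apply, LinearMap.fst_apply, LinearMap.snd_apply]
    rw [← h, Submonoid.smul_def, Submonoid.smul_def, map_smul]
  exists_of_eq := by
    rintro ⟨⟨p, v⟩, h⟩ ⟨⟨p', v'⟩, h'⟩ e
    simp only [LinearMap.mem_eqLocus, LinearMap.comp_apply, LinearMap.fst_apply,
      LinearMap.snd_apply, Submodule.subtype_apply] at h h' e
    subst e
    obtain ⟨c, hc⟩ := IsLocalizedModule.exists_of_eq (S := S) (f := ψ) (h.symm.trans h')
    refine ⟨c, Subtype.ext (Prod.ext rfl hc)⟩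

lemma snd_loc (S : Submonoid B) [IsLocalizedModule S φ]
    (hN : ∀ x : S, IsUnit (algebraMap B (Module.End B N) x)) :
    IsLocalizedModule S (LinearMap.snd B P N ∘ₗ (FibreProd φ ψ).subtype) where
  map_units := hN
  surj y := by
    obtain ⟨⟨v, s⟩, h⟩ := IsLocalizedModule.surj S φ (ψ y)
    refine ⟨⟨⟨(v, s • y), ?_⟩, s⟩, rfl⟩
    simp only [LinearMap.mem_eqLocus, LinearMap.comp_apply, LinearMap.fst_apply, LinearMap.snd_apply]
    rw [← h, Submonoid.smul_def, Submonoid.smul_def, map_smul]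
  exists_of_eq := by
    rintro ⟨⟨p, v⟩, h⟩ ⟨⟨p', v'⟩, h'⟩ e
    simp only [LinearMap.mem_eqLocus, LinearMap.comp_apply, LinearMap.fst_apply,
      LinearMap.snd_apply, Submodule.subtype_apply] at h h' e
    subst e
    obtain ⟨c, hc⟩ := IsLocalizedModule.exists_of_eq (S := S) (f := φ) (h.trans h'.symm)
    refine ⟨c, Subtype.ext (Prod.ext hc rfl)⟩
end fp

lemma units_of_loc {B A P : Type*} [CommRing B] [CommRing A] [Algebra B A] [AddCommGroup P]
    [Module B P] [Module A P] [IsScalarTower B A P] (S : Submonoid B) [IsLocalization S A]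
    (x : S) : IsUnit (algebraMap B (Module.End B P) x) := by
  have h := (IsLocalization.map_units A x).map (Algebra.lsmul B B P)
  convert h using 1
  ext p
  simp

lemma locprop {B Q M : Type*} [CommRing B] [AddCommGroup Q] [Module B Q] (r : B)
    [AddCommGroup M] [Module B M] [Module (Localization.Away r) M]
    [IsScalarTower B (Localization.Away r) M] (q : Q →ₗ[B] M)
    [IsLocalizedModule (Submonoid.powers r) q] [Module.Finite (Localization.Away r) M]
    [Module.Projective (Localization.Away r) M] :
    Module.Finite (Localization.Away r) (LocalizedModule.Away r Q) ∧
    Module.Projective (Localization.Away r) (LocalizedModule.Away r Q) := by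
  let e := ((IsLocalizedModule.iso (Submonoid.powers r) q).extendScalarsOfIsLocalization
    (Submonoid.powers r) (Localization.Away r)).symm
  exact ⟨Module.Finite.equiv e, Module.Projective.of_equiv e⟩

lemma finproj {B Q : Type*} [CommRing B] [AddCommGroup Q] [Module B Q] (s : Set B)
    (hs : Ideal.span s = ⊤)
    (h : ∀ r ∈ s, Module.Finite (Localization.Away r) (LocalizedModule.Away r Q) ∧
    Module.Projective (Localization.Away r) (LocalizedModule.Away r Q)) :
    Module.Finite B Q ∧ Module.Projective B Q := by
  have h1 : Module.FinitePresentation B Q := by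
    refine Module.FinitePresentation.of_localizationSpan s hs fun g => ?_
    have := (h g g.2).1
    have := (h g g.2).2
    exact Module.finitePresentation_of_projective _ _
  have h2 : Module.Flat B Q := by
    refine Module.flat_of_localized_span (S := B) Q s hs fun g => ?_
    have := (h g g.2).2
    have : Module.Flat B (Localization.Away g.1) := IsLocalization.flat _ (Submonoid.powers g.1)
    exact Module.Flat.trans B (Localization.Away g.1) _
  exact ⟨inferInstance, Module.Flat.projective_of_finitePresentation⟩

lemma patch_core {B : Type u} [CommRing B] (hB : AllFree B) (f : B) (S : Submonoid B)
    (hS : ∀ g ∈ S, IsCoprime f g)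
    (hD : AllFree (Localization (Algebra.algebraMapSubmonoid (Localization.Away f) S)))
    (P : Type u) [AddCommGroup P] [Module B P] [Module (Localization.Away f) P]
    [IsScalarTower B (Localization.Away f) P]
    [Module.Finite (Localization.Away f) P] [Module.Projective (Localization.Away f) P] :
    Module.Free (Localization.Away f) P := by
  set A := Localization.Away f with hA
  set S' := Algebra.algebraMapSubmonoid A S
  have hfree : Module.Free (Localization S') (LocalizedModule S' P) :=
    hD _ (Module.Finite.of_isLocalizedModule S' (LocalizedModule.mkLinearMap S' P)) inferInstance
  have : Module.FinitePresentation A P := Module.finitePresentation_of_projective _ _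
  have : Module.Finite (Localization S') (LocalizedModule S' P) :=
    Module.Finite.of_isLocalizedModule S' (LocalizedModule.mkLinearMap S' P)
  obtain ⟨s, ⟨g, hg, rfl⟩, b, -⟩ :=
    Module.FinitePresentation.exists_basis_localizedModule_powers S'
      (LocalizedModule.mkLinearMap S' P) (Localization S')
      (Module.Free.chooseBasis (Localization S') (LocalizedModule S' P))
  set ι := Module.Free.ChooseBasisIndex (Localization S') (LocalizedModule S' P)
  set s : A := algebraMap B A g with hs
  change Module.Basis ι (Localization.Away s) (LocalizedModule.Away s P) at b
  let C := Localization.Away s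
  let φ' : P →ₗ[A] (ι →₀ C) :=
    (b.repr.restrictScalars A).toLinearMap ∘ₗ LocalizedModule.mkLinearMap (Submonoid.powers s) P
  have : IsLocalizedModule (Submonoid.powers s) φ' := IsLocalizedModule.of_linearEquiv _ _ _
  let φ : P →ₗ[B] (ι →₀ C) := φ'.restrictScalars B
  have : IsLocalizedModule (Submonoid.powers g) φ := IsLocalizedModule.restrictScalars_powers g φ'
  let Bg := Localization.Away g
  have hunit : IsUnit (algebraMap B C g) := by
    rw [IsScalarTower.algebraMap_apply B A C]
    exact IsLocalization.Away.algebraMap_isUnit s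
  let : Algebra Bg C := (IsLocalization.Away.lift (S := Bg) g hunit).toAlgebra
  have : IsScalarTower B Bg C := IsScalarTower.of_algebraMap_eq fun x =>
    (IsLocalization.Away.lift_eq g hunit x).symm
  have : IsLocalization.Away (algebraMap B Bg f) C :=
    IsLocalization.Away.commutes Bg A C g f
  have : IsLocalization (Algebra.algebraMapSubmonoid Bg (Submonoid.powers f)) C := by
    rw [Algebra.algebraMapSubmonoid_powers]; assumption
  let ψ : (ι →₀ Bg) →ₗ[B] (ι →₀ C) :=
    Finsupp.mapRange.linearMap (IsScalarTower.toAlgHom B Bg C).toLinearMap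
  have : IsLocalizedModule (Submonoid.powers f) ψ := inferInstance
  have l1 := fst_loc (P := P) (N := ι →₀ Bg) (L := ι →₀ C) φ ψ (Submonoid.powers f) (units_of_loc (A := A) _)
  have l2 := snd_loc (P := P) (N := ι →₀ Bg) (L := ι →₀ C) φ ψ (Submonoid.powers g) (units_of_loc (A := Bg) _)
  have hQ : Module.Finite B (FibreProd (P := P) (N := ι →₀ Bg) (L := ι →₀ C) φ ψ) ∧ Module.Projective B (FibreProd (P := P) (N := ι →₀ Bg) (L := ι →₀ C) φ ψ) := by
    refine finproj (Q := FibreProd (P := P) (N := ι →₀ Bg) (L := ι →₀ C) φ ψ) {f, g} ?_ ?_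
    · obtain ⟨a, b, hab⟩ := hS g hg
      rw [Ideal.eq_top_iff_one, Ideal.mem_span_pair]
      exact ⟨a, b, hab⟩
    · rintro r (rfl | rfl)
      · exact locprop _ (LinearMap.fst B P (ι →₀ Bg) ∘ₗ (FibreProd (P := P) (N := ι →₀ Bg) (L := ι →₀ C) φ ψ).subtype)
      · exact locprop _ (LinearMap.snd B P (ι →₀ Bg) ∘ₗ (FibreProd (P := P) (N := ι →₀ Bg) (L := ι →₀ C) φ ψ).subtype)
  have := hB (FibreProd (P := P) (N := ι →₀ Bg) (L := ι →₀ C) φ ψ) hQ.1 hQ.2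
  exact Module.free_of_isLocalizedModule
    (M := FibreProd (P := P) (N := ι →₀ Bg) (L := ι →₀ C) φ ψ) (Submonoid.powers f)
    (LinearMap.fst B P (ι →₀ Bg) ∘ₗ (FibreProd (P := P) (N := ι →₀ Bg) (L := ι →₀ C) φ ψ).subtype)

lemma patch {B : Type u} [CommRing B] (hB : AllFree B) (f : B) (S : Submonoid B)
    (hS : ∀ g ∈ S, IsCoprime f g)
    (hD : AllFree (Localization (Algebra.algebraMapSubmonoid (Localization.Away f) S))) :
    AllFree (Localization.Away f) := by
  intro P _ _ _ _
  let : Module B P := Module.compHom P (algebraMap B (Localization.Away f))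
  have : IsScalarTower B (Localization.Away f) P := IsScalarTower.of_algebraMap_smul fun _ _ => rfl
  exact patch_core hB f S hS hD P

/-- The submonoid `1 + fR[Y]`. -/
def onePlus {R : Type u} [CommRing R] (f : R) : Submonoid R where
  carrier := {g | ∃ q, g = 1 + f * q}
  one_mem' := ⟨0, by simp⟩
  mul_mem' := by
    rintro _ _ ⟨a, rfl⟩ ⟨b, rfl⟩
    exact ⟨a + b + f * a * b, by ring⟩

lemma allFree_retract_step {R D : Type u} [CommRing R] [CommRing D] (n m : ℕ) (hm : m + 1 ≤ n)
    (f : Fin (m + 1) → Polynomial R)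
    (M : Submonoid R[X])
    (E0 : AllFree (LocalizedPolynomialRing (Localization M) n m (Nat.le_of_succ_le hm)
      (fun i => (f i.castSucc).map ((algebraMap R[X] (Localization M)).comp C))))
    (δ : MvPolynomial (Fin n) R →+* D)
    (hext : ∀ g h : D →+* D, g.comp δ = h.comp δ → g = h)
    (hM : ∀ x ∈ M, IsUnit (δ (aeval (MvPolynomial.X (Fin.castLE hm (Fin.last m))) x)))
    (hu : ∀ i : Fin m, IsUnit (δ (aeval (MvPolynomial.X (Fin.castLE hm i.castSucc)) (f i.castSucc))))
    (hlift : ∀ (E : Type u) [CommRing E] (θ : MvPolynomial (Fin n) R →+* E),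
      (∀ i : Fin m, IsUnit (θ (aeval (MvPolynomial.X (Fin.castLE hm i.castSucc)) (f i.castSucc)))) →
      (∀ x ∈ M, IsUnit (θ (aeval (MvPolynomial.X (Fin.castLE hm (Fin.last m))) x))) →
      ∃ i : D →+* E, i.comp δ = θ) : AllFree D := by
  set R' := Localization M
  set ρ : R →+* R' := (algebraMap R[X] R').comp C
  set E := LocalizedPolynomialRing R' n m (Nat.le_of_succ_le hm) (fun i => (f i.castSucc).map ρ)
  set k := Fin.castLE hm (Fin.last m) with hk
  set θ0 : MvPolynomial (Fin n) R →+* MvPolynomial (Fin n) R' :=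
    MvPolynomial.eval₂Hom (MvPolynomial.C.comp ρ)
      (fun j => if j = k then MvPolynomial.C (algebraMap R[X] R' X) else MvPolynomial.X j) with hθ0
  have e1 : ∀ p : R[X], θ0 (aeval (MvPolynomial.X k) p) = MvPolynomial.C (algebraMap R[X] R' p) := by
    intro p
    have : θ0.comp (aeval (R := R) (MvPolynomial.X k : MvPolynomial (Fin n) R)).toRingHom =
        MvPolynomial.C.comp (algebraMap R[X] R') := by
      apply Polynomial.ringHom_ext
      · intro a
        simp [θ0, ρ, MvPolynomial.algebraMap_eq]
      · simp [θ0]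
    exact RingHom.congr_fun this p
  have e2 : ∀ j, j ≠ k → ∀ p : R[X], θ0 (aeval (MvPolynomial.X j) p) =
      aeval (MvPolynomial.X j) (p.map ρ) := by
    intro j hj p
    have : θ0.comp (aeval (R := R) (MvPolynomial.X j : MvPolynomial (Fin n) R)).toRingHom =
        (aeval (R := R') (MvPolynomial.X j : MvPolynomial (Fin n) R')).toRingHom.comp
          (Polynomial.mapRingHom ρ) := by
      apply Polynomial.ringHom_ext
      · intro a
        simp [θ0, MvPolynomial.algebraMap_eq]
      · simp [θ0, hj]
    exact RingHom.congr_fun this p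
  obtain ⟨i, hi⟩ := hlift E ((algebraMap _ E).comp θ0) (by
      intro i
      have hne : Fin.castLE hm i.castSucc ≠ k := by
        intro h
        have := congrArg Fin.val h
        simp [hk] at this
        omega
      rw [RingHom.comp_apply, e2 _ hne]
      have h := IsLocalization.Away.algebraMap_isUnit (S := E)
        (∏ i : Fin m, Polynomial.aeval (MvPolynomial.X (Fin.castLE (Nat.le_of_succ_le hm) i))
          ((f i.castSucc).map ρ) : MvPolynomial (Fin n) R')
      rw [map_prod] at h
      exact (IsUnit.prod_univ_iff).1 h i) (by
      intro x hx
      rw [RingHom.comp_apply, e1]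
      exact ((IsLocalization.map_units R' ⟨x, hx⟩).map MvPolynomial.C).map _)
  let σ : R' →+* D := IsLocalization.lift (M := M)
    (g := δ.comp (aeval (R := R) (MvPolynomial.X k : MvPolynomial (Fin n) R)).toRingHom)
    (fun y => hM y y.2)
  have hσ : ∀ p : R[X], σ (algebraMap R[X] R' p) = δ (aeval (MvPolynomial.X k) p) :=
    fun p => IsLocalization.lift_eq _ _
  let π0 : MvPolynomial (Fin n) R' →+* D :=
    MvPolynomial.eval₂Hom σ (fun j => δ (MvPolynomial.X j))
  have e3 : ∀ j, ∀ p : R[X], π0 (aeval (MvPolynomial.X j) (p.map ρ)) =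
      δ (aeval (MvPolynomial.X j) p) := by
    intro j p
    have : (π0.comp (aeval (R := R') (MvPolynomial.X j : MvPolynomial (Fin n) R')).toRingHom).comp
          (Polynomial.mapRingHom ρ) =
        δ.comp (aeval (R := R) (MvPolynomial.X j : MvPolynomial (Fin n) R)).toRingHom := by
      apply Polynomial.ringHom_ext
      · intro a
        simp [π0, ρ, MvPolynomial.algebraMap_eq, hσ]
      · simp [π0]
    exact RingHom.congr_fun this p
  have hunit : IsUnit (π0 (∏ i : Fin m, Polynomial.aeval
      (MvPolynomial.X (Fin.castLE (Nat.le_of_succ_le hm) i))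
          ((f i.castSucc).map ρ) : MvPolynomial (Fin n) R')) := by
    rw [map_prod]
    refine (IsUnit.prod_univ_iff).2 fun i => ?_
    rw [e3]
    exact hu i
  let π : E →+* D := IsLocalization.Away.lift _ hunit
  have hπ : ∀ y, π (algebraMap _ E y) = π0 y := fun y => IsLocalization.Away.lift_eq _ hunit y
  refine E0.retract i π (hext _ _ ?_)
  rw [RingHom.comp_assoc, hi]
  apply MvPolynomial.ringHom_ext
  · intro a
    simp only [RingHom.comp_apply, hπ]
    simp [θ0, π0, ρ, hσ, MvPolynomial.algebraMap_eq]
  · intro j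
    simp only [RingHom.comp_apply, hπ]
    by_cases h : j = k
    · simp [θ0, π0, hσ, h]
    · simp [θ0, π0, h]

lemma main_allFree (n : ℕ) (Sig : ∀ (R : Type u) [CommRing R], Prop)
    (h1 : ∀ (R : Type u) [CommRing R], Sig R →
      ∀ f : Polynomial R, f ≠ 0 → ¬ IsUnit f →
        Sig (Localization
          (Submonoid.closure ({f} ∪ {g : Polynomial R | ∃ q : Polynomial R, g = 1 + f * q}))))
    (h2 : ∀ (R : Type u) [CommRing R], Sig R → AllFree (MvPolynomial (Fin n) R)) (m : ℕ) :
    ∀ (R : Type u) [CommRing R], Sig R → ∀ (hmn : m ≤ n) (f : Fin m → Polynomial R),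
      AllFree (LocalizedPolynomialRing R n m hmn f) := by
  induction m with
  | zero =>
    intro R _ hR hmn f
    let x : MvPolynomial (Fin n) R :=
      ∏ i : Fin 0, Polynomial.aeval (MvPolynomial.X (Fin.castLE hmn i)) (f i)
    have hx : IsUnit (RingHom.id _ x) := by simp [x]
    refine (h2 R hR).retract (IsLocalization.Away.lift x hx) (algebraMap _ _) ?_
    apply IsLocalization.ringHom_ext (Submonoid.powers x)
    rw [RingHom.comp_assoc, IsLocalization.Away.lift_comp]
    rfl
  | succ m ih =>
    intro R _ hR hm f
    set k := Fin.castLE hm (Fin.last m) with hk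
    let B := LocalizedPolynomialRing R n m (Nat.le_of_succ_le hm) (fun i => f i.castSucc)
    have hB : AllFree B := ih R hR _ _
    let x : MvPolynomial (Fin n) R :=
      ∏ i : Fin m, Polynomial.aeval (MvPolynomial.X (Fin.castLE (Nat.le_of_succ_le hm) i))
        (f i.castSucc)
    let y : MvPolynomial (Fin n) R := Polynomial.aeval (MvPolynomial.X k) (f (Fin.last m))
    let F : B := algebraMap _ B y
    let A := Localization.Away F
    have hBx : IsLocalization.Away x B := inferInstanceAs (IsLocalization.Away x (Localization.Away x))
    suffices hA : AllFree A by
      have hAxy : IsLocalization.Away (x * y) A := IsLocalization.Away.mul' B A x y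
      have hxy : (∏ i : Fin (m + 1), Polynomial.aeval (MvPolynomial.X (Fin.castLE hm i)) (f i) :
          MvPolynomial (Fin n) R) = x * y := Fin.prod_univ_castSucc _
      have hL : IsLocalization.Away (x * y) (LocalizedPolynomialRing R n (m + 1) hm f) := by
        rw [← hxy]; infer_instance
      let e : LocalizedPolynomialRing R n (m + 1) hm f ≃ₐ[MvPolynomial (Fin n) R] A :=
        IsLocalization.algEquiv (Submonoid.powers (x * y)) _ _
      refine hA.retract (e : _ →+* A) (e.symm : A →+* _) ?_
      ext z
      simp
    by_cases hf0 : f (Fin.last m) = 0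
    · have hF : F = 0 := by simp [F, y, hf0]
      have hu : IsUnit (algebraMap B A F) := IsLocalization.Away.algebraMap_isUnit F
      have hz : algebraMap B A F = 0 := (congrArg _ hF).trans (map_zero _)
      rw [hz, isUnit_zero_iff] at hu
      have : Subsingleton A := subsingleton_of_zero_eq_one hu
      intro P _ _ _ _
      exact Module.Free.of_subsingleton' A P
    by_cases hfu : IsUnit (f (Fin.last m))
    · have hF : IsUnit (RingHom.id B F) := 
        (hfu.map (aeval (R := R) (MvPolynomial.X k : MvPolynomial (Fin n) R))).map
          (algebraMap (MvPolynomial (Fin n) R) B)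
      refine hB.retract (IsLocalization.Away.lift F hF) (algebraMap _ _) ?_
      apply IsLocalization.ringHom_ext (Submonoid.powers F)
      rw [RingHom.comp_assoc, IsLocalization.Away.lift_comp]
      rfl
    let ev : R[X] →+* B := (algebraMap _ B).comp
      (aeval (R := R) (MvPolynomial.X k : MvPolynomial (Fin n) R)).toRingHom
    have hev : ∀ p, ev p = algebraMap (MvPolynomial (Fin n) R) B (aeval (MvPolynomial.X k) p) := fun _ => rfl
    let S : Submonoid B := (onePlus (f (Fin.last m))).map ev
    refine patch hB F S ?_ ?_
    · rintro _ ⟨_, ⟨q, rfl⟩, rfl⟩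
      refine ⟨- ev q, 1, ?_⟩
      have : F = ev (f (Fin.last m)) := rfl
      rw [map_add, map_mul, map_one, this]
      ring
    let T := Algebra.algebraMapSubmonoid A S
    let D := Localization T
    let M := Submonoid.closure ({f (Fin.last m)} ∪
      {g : Polynomial R | ∃ q : Polynomial R, g = 1 + f (Fin.last m) * q})
    refine allFree_retract_step (D := D) n m hm f M (ih _ (h1 R hR _ hf0 hfu) _ _)
      (((algebraMap A D).comp (algebraMap B A)).comp (algebraMap _ B)) ?_ ?_ ?_ ?_
    · intro g h hgh
      apply IsLocalization.ringHom_ext T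
      apply IsLocalization.ringHom_ext (Submonoid.powers F)
      apply IsLocalization.ringHom_ext (Submonoid.powers x)
      exact hgh
    · suffices M ≤ (IsUnit.submonoid D).comap
          (((algebraMap A D).comp (algebraMap B A)).comp ev : R[X] →* D) from
        fun z hz => this hz
      rw [Submonoid.closure_le]
      rintro z (hz | hz)
      · rw [Set.mem_singleton_iff] at hz
        subst hz
        exact (IsLocalization.Away.algebraMap_isUnit (S := A) F).map (algebraMap A D)
      · exact IsLocalization.map_units D (⟨algebraMap B A (ev z), ⟨ev z, ⟨z, hz, rfl⟩, rfl⟩⟩ : T)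
    · intro i
      have h := IsLocalization.Away.algebraMap_isUnit (S := B) x
      rw [map_prod] at h
      exact (((IsUnit.prod_univ_iff).1 h i).map
        (algebraMap B A)).map (algebraMap A D)
    · intro E _ θ hu hv
      have u1 : IsUnit (θ x) := by
        rw [map_prod]
        exact (IsUnit.prod_univ_iff).2 hu
      let θ1 : B →+* E := IsLocalization.Away.lift x u1
      have t1 : ∀ z, θ1 (algebraMap _ B z) = θ z := fun z => IsLocalization.Away.lift_eq x u1 z
      have u2 : IsUnit (θ1 F) := by
        rw [t1]
        exact hv _ (Submonoid.subset_closure (Or.inl rfl))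
      let θ2 : A →+* E := IsLocalization.Away.lift F u2
      have t2 : ∀ z, θ2 (algebraMap B A z) = θ1 z := fun z => IsLocalization.Away.lift_eq F u2 z
      have u3 : ∀ z : T, IsUnit (θ2 z) := by
        rintro ⟨_, ⟨_, ⟨z, hz, rfl⟩, rfl⟩⟩
        change IsUnit (θ2 (algebraMap B A (ev z)))
        rw [t2, hev, t1]
        exact hv _ (Submonoid.subset_closure (Or.inr hz))
      let θ3 : D →+* E := IsLocalization.lift (M := T) (S := D) u3
      have t3 : ∀ z, θ3 (algebraMap A D z) = θ2 z := fun z => IsLocalization.lift_eq u3 z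
      refine ⟨θ3, RingHom.ext fun z => ?_⟩
      simp only [RingHom.comp_apply]
      rw [t3, t2, t1]


/-- Let `Σ` be a class of commutative rings closed under ring isomorphism
and `n` a natural number such that: (i) whenever `R ∈ Σ` and `f ∈ R[Y]` is a nonzero
non-unit, the localization of `R[Y]` at the multiplicative set generated by `f` and
`1 + f·R[Y]` is in `Σ`; (ii) whenever `R ∈ Σ`, all finitely generated projective modules
over `R[Y₁,…,Yₙ]` are free.  Then for `R ∈ Σ`, `m ≤ n` and `fᵢ ∈ R[Yᵢ]`, every finitely
generated projective module over `A = R[Y₁,…,Yₙ][(f₁⋯f_m)⁻¹]` is free. -/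
theorem statement_0 (n : ℕ) (Sig : ∀ (R : Type u) [CommRing R], Prop)
    (hiso : ∀ (R S : Type u) [CommRing R] [CommRing S], (R ≃+* S) → Sig R → Sig S)
    (h1 : ∀ (R : Type u) [CommRing R], Sig R →
      ∀ f : Polynomial R, f ≠ 0 → ¬ IsUnit f →
        Sig (Localization
          (Submonoid.closure ({f} ∪ {g : Polynomial R | ∃ q : Polynomial R, g = 1 + f * q}))))
    (h2 : ∀ (R : Type u) [CommRing R], Sig R →
      ∀ (P : Type u) [AddCommGroup P] [Module (MvPolynomial (Fin n) R) P],
        Module.Finite (MvPolynomial (Fin n) R) P →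
        Module.Projective (MvPolynomial (Fin n) R) P →
        Module.Free (MvPolynomial (Fin n) R) P)
    (R : Type u) [CommRing R] (hR : Sig R)
    (m : ℕ) (hmn : m ≤ n) (f : Fin m → Polynomial R)
    (P : Type u) [AddCommGroup P] [Module (LocalizedPolynomialRing R n m hmn f) P]
    [Module.Finite (LocalizedPolynomialRing R n m hmn f) P]
    [Module.Projective (LocalizedPolynomialRing R n m hmn f) P] :
    Module.Free (LocalizedPolynomialRing R n m hmn f) P := by
  exact main_allFree n Sig h1 (fun R _ hR P _ _ => h2 R hR P) m R hR hmn f P inferInstance inferInstance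
end

section
/- Let R be a commutative ring of finite Krull dimension d and A = R[Y] the polynomial ring in one variable over R. Let P be a finitely generated projective A-module of constant rank r ≥ d+1 which satisfies property Ω(R). Then E(A ⊕ P) acts transitively on Um(A ⊕ P). -/
open Polynomial

/-- An element `m` of an `A`-module `M` is unimodular if some linear functional sends it to `1`. -/
def IsUnimodular (A : Type*) [CommRing A] (M : Type*) [AddCommGroup M] [Module A M]
    (m : M) : Prop :=
  ∃ φ : M →ₗ[A] A, φ m = 1

/-- `E(M)`: the subgroup of `Aut_A(M)` generated by transvections, i.e. automorphisms of the
form `q ↦ q + φ(q) • p` with `φ(p) = 0` and `p` unimodular or `φ` unimodular. -/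
def TransvectionGroup (A : Type*) [CommRing A] (M : Type*) [AddCommGroup M] [Module A M] :
    Subgroup (M ≃ₗ[A] M) :=
  Subgroup.closure {σ : M ≃ₗ[A] M | ∃ (p : M) (φ : M →ₗ[A] A), φ p = 0 ∧
    (IsUnimodular A M p ∨ IsUnimodular A (M →ₗ[A] A) φ) ∧ ∀ q : M, σ q = q + φ q • p}

/-- A projective module has constant rank `r` if its localization at every prime is free of
rank `r`. -/
def HasConstantRank (A : Type*) [CommRing A] (P : Type*) [AddCommGroup P] [Module A P]
    (r : ℕ) : Prop :=
  ∀ (𝔭 : Ideal A) (h𝔭 : 𝔭.IsPrime),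
    haveI := h𝔭
    Module.Free (Localization.AtPrime 𝔭) (LocalizedModule 𝔭.primeCompl P) ∧
    Module.finrank (Localization.AtPrime 𝔭) (LocalizedModule 𝔭.primeCompl P) = r

/-- Property `Ω(R)` for a projective module `P` over an `R`-algebra `S`. -/
def PropertyOmega (R : Type*) [CommRing R] (S : Type*) [CommRing S] [Algebra R S]
    (P : Type*) [AddCommGroup P] [Module S P] : Prop :=
  ∀ I : Ideal R, ∃ t : R,
    Ideal.Quotient.mk I t ∈ nonZeroDivisors (R ⧸ I) ∧
    Module.Free
      (Localization (Submonoid.powers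
        (Ideal.Quotient.mk (I.map (algebraMap R S)) (algebraMap R S t))))
      (LocalizedModule (Submonoid.powers
        (Ideal.Quotient.mk (I.map (algebraMap R S)) (algebraMap R S t)))
        (P ⧸ ((I.map (algebraMap R S)) • ⊤ : Submodule S P)))

namespace Um3

set_option linter.unusedSectionVars false

section generic
variable {A : Type*} [CommRing A] {ι : Type*} [DecidableEq ι]

/-- elementary operations with weights `p`, `q` on the positions in `S` -/
inductive EStep (p q : Ideal A) (S : Finset ι) : A × (ι → A) → A × (ι → A) → Prop
  | addv (u : A) (v : ι → A) (i : ι) (c : A) (hi : i ∈ S) (hc : c ∈ p) :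
      EStep p q S (u, v) (u, Function.update v i (v i + c * u))
  | addu (u : A) (v : ι → A) (i : ι) (c : A) (hi : i ∈ S) (hc : c ∈ q) :
      EStep p q S (u, v) (u + c * v i, v)

/-- congruence modulo `J` on the positions in `S` -/
def Cg (J : Ideal A) (S : Finset ι) (x y : A × (ι → A)) : Prop :=
  y.1 - x.1 ∈ J ∧ ∀ i ∈ S, y.2 i - x.2 i ∈ J

def EReach (p q : Ideal A) (S : Finset ι) : A × (ι → A) → A × (ι → A) → Prop :=
  Relation.ReflTransGen (EStep p q S)

def Reach (J p q : Ideal A) (S : Finset ι) : A × (ι → A) → A × (ι → A) → Prop :=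
  Relation.ReflTransGen (fun x y => EStep p q S x y ∨ Cg J S x y)

def Un (J : Ideal A) (S : Finset ι) (x : A × (ι → A)) : Prop :=
  ∀ M : Ideal A, M.IsPrime → J ≤ M → x.1 ∈ M → ∃ i ∈ S, x.2 i ∉ M

def Inv (J p q : Ideal A) (S : Finset ι) (x : A × (ι → A)) : Prop :=
  x.1 - 1 ∈ p * q ⊔ J ∧ ∀ i ∈ S, x.2 i ∈ p ⊔ J

variable {J p q : Ideal A} {S : Finset ι}

lemma Cg.refl (x : A × (ι → A)) : Cg J S x x := by simp [Cg]

lemma Cg.symm {x y : A × (ι → A)} (h : Cg J S x y) : Cg J S y x := by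
  refine ⟨?_, fun i hi => ?_⟩
  · rw [← neg_sub]; exact J.neg_mem h.1
  · rw [← neg_sub]; exact J.neg_mem (h.2 i hi)

lemma Cg.trans {x y z : A × (ι → A)} (h : Cg J S x y) (h' : Cg J S y z) : Cg J S x z := by
  refine ⟨?_, fun i hi => ?_⟩
  · have := J.add_mem h.1 h'.1; convert this using 1; ring
  · have := J.add_mem (h.2 i hi) (h'.2 i hi); convert this using 1; ring

lemma EReach.mono {p' q' : Ideal A} {S' : Finset ι} {x y : A × (ι → A)} (h : EReach p q S x y)
    (hp : p ≤ p') (hq : q ≤ q') (hS : S ⊆ S') : EReach p' q' S' x y := by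
  refine Relation.ReflTransGen.mono ?_ _ _ h
  rintro _ _ (⟨u, v, i, c, hi, hc⟩ | ⟨u, v, i, c, hi, hc⟩)
  · exact .addv u v i c (hS hi) (hp hc)
  · exact .addu u v i c (hS hi) (hq hc)

lemma EReach.reach {x y : A × (ι → A)} (h : EReach p q S x y) : Reach J p q S x y :=
  Relation.ReflTransGen.mono (fun _ _ h => Or.inl h) _ _ h

lemma Cg.reach {x y : A × (ι → A)} (h : Cg J S x y) : Reach J p q S x y :=
  Relation.ReflTransGen.single (Or.inr h)

lemma Reach.trans {x y z : A × (ι → A)} (h : Reach J p q S x y) (h' : Reach J p q S y z) :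
    Reach J p q S x z := Relation.ReflTransGen.trans h h'

lemma reach_addv {u : A} {v : ι → A} {i : ι} {c : A} (hi : i ∈ S) (hc : c ∈ p) :
    Reach J p q S (u, v) (u, Function.update v i (v i + c * u)) :=
  Relation.ReflTransGen.single (Or.inl (.addv u v i c hi hc))

lemma reach_addu {u : A} {v : ι → A} {i : ι} {c : A} (hi : i ∈ S) (hc : c ∈ q) :
    Reach J p q S (u, v) (u + c * v i, v) :=
  Relation.ReflTransGen.single (Or.inl (.addu u v i c hi hc))

lemma reach_addv' {u : A} {v : ι → A} {i : ι} {c w : A} (hi : i ∈ S) (hc : c ∈ p ⊔ J)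
    (hw : w - (v i + c * u) ∈ J) :
    Reach J p q S (u, v) (u, Function.update v i w) := by
  obtain ⟨c', hc', j, hj, rfl⟩ := Submodule.mem_sup.1 hc
  refine (reach_addv hi hc').trans (Cg.reach ⟨by simp, fun k hk => ?_⟩)
  by_cases hki : k = i
  · subst hki
    have := J.add_mem hw (J.mul_mem_right u hj)
    simp only [Function.update_self]
    convert this using 1; ring
  · simp [hki]

lemma reach_addu' {u : A} {v : ι → A} {i : ι} {c w : A} (hi : i ∈ S) (hc : c ∈ q ⊔ J)
    (hw : w - (u + c * v i) ∈ J) :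
    Reach J p q S (u, v) (w, v) := by
  obtain ⟨c', hc', j, hj, rfl⟩ := Submodule.mem_sup.1 hc
  refine (reach_addu hi hc').trans (Cg.reach ⟨?_, fun k hk => by simp⟩)
  have := J.add_mem hw (J.mul_mem_right (v i) hj)
  simp only
  convert this using 1; ring

lemma Reach.extract {x y : A × (ι → A)} (h : Reach J p q S x y) :
    ∃ z, EReach p q S x z ∧ Cg J S z y := by
  induction h with
  | refl => exact ⟨x, .refl, Cg.refl x⟩
  | tail _ h ih =>
    obtain ⟨z, hz, hc⟩ := ih
    rcases h with h | h
    · obtain ⟨z1, z2⟩ := z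
      rcases h with ⟨u, v, i, c, hi, hc'⟩ | ⟨u, v, i, c, hi, hc'⟩
      · refine ⟨_, hz.tail (.addv z1 z2 i c hi hc'), hc.1, fun k hk => ?_⟩
        by_cases hki : k = i
        · subst hki
          have := J.add_mem (hc.2 k hk) (J.mul_mem_left c hc.1)
          simp only [Function.update_self]
          convert this using 1; ring
        · simpa [hki] using hc.2 k hk
      · refine ⟨_, hz.tail (.addu z1 z2 i c hi hc'), ?_, hc.2⟩
        have := J.add_mem hc.1 (J.mul_mem_left c (hc.2 i hi))
        convert this using 1; ring
    · exact ⟨z, hz, hc.trans h⟩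

lemma EReach.off {x y : A × (ι → A)} (h : EReach p q S x y) {i : ι} (hi : i ∉ S) :
    y.2 i = x.2 i := by
  induction h with
  | refl => rfl
  | tail _ h ih =>
    rcases h with ⟨u, v, k, c, hk, hc'⟩ | ⟨u, v, k, c, hk, hc'⟩
    · rw [← ih]
      have : i ≠ k := fun h => hi (h ▸ hk)
      simp [this]
    · exact ih

lemma EReach.cg {x y : A × (ι → A)} (h : EReach p q S x y) (hp : p ≤ J) (hq : q ≤ J)
    {T : Finset ι} : Cg J T x y := by
  induction h with
  | refl => exact Cg.refl x
  | tail _ h ih =>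
    refine ih.trans ?_
    rcases h with ⟨u, v, k, c, hk, hc'⟩ | ⟨u, v, k, c, hk, hc'⟩
    · refine ⟨by simp, fun i hi => ?_⟩
      by_cases hik : i = k
      · subst hik; simpa using J.mul_mem_right u (hp hc')
      · simp [hik]
    · exact ⟨by simpa using J.mul_mem_right (v k) (hq hc'), fun i hi => by simp⟩

lemma Cg.inv {x y : A × (ι → A)} (h : Cg J S x y) (hx : Inv J p q S x) : Inv J p q S y := by
  refine ⟨?_, fun i hi => ?_⟩
  · have := Ideal.add_mem _ hx.1 ((Ideal.mem_sup_right h.1 : _ ∈ p * q ⊔ J))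
    convert this using 1; ring
  · have := Ideal.add_mem _ (hx.2 i hi) ((Ideal.mem_sup_right (h.2 i hi) : _ ∈ p ⊔ J))
    convert this using 1; ring

lemma Reach.inv {x y : A × (ι → A)} (h : Reach J p q S x y) (hx : Inv J p q S x) :
    Inv J p q S y := by
  induction h with
  | refl => exact hx
  | tail _ h ih =>
    rcases h with h | h
    · rcases h with ⟨u, v, k, c, hk, hc'⟩ | ⟨u, v, k, c, hk, hc'⟩
      · refine ⟨ih.1, fun i hi => ?_⟩
        by_cases hik : i = k
        · subst hik
          simp only [Function.update_self]
          exact Ideal.add_mem _ (ih.2 i hi) (Ideal.mem_sup_left (p.mul_mem_right u hc'))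
        · simpa [hik] using ih.2 i hi
      · refine ⟨?_, ih.2⟩
        have h1 : c * v k ∈ p * q ⊔ J := by
          obtain ⟨a, ha, j, hj, e⟩ := Submodule.mem_sup.1 (ih.2 k hk)
          simp only at e
          rw [← e, mul_add]
          refine Ideal.add_mem _ (Ideal.mem_sup_left ?_) (Ideal.mem_sup_right (J.mul_mem_left _ hj))
          rw [mul_comm p q]; exact Ideal.mul_mem_mul hc' ha
        have := Ideal.add_mem _ ih.1 h1
        convert this using 1; simp only; ring
    · exact h.inv ih

lemma Reach.un {x y : A × (ι → A)} (h : Reach J p q S x y) (hx : Un J S x) :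
    Un J S y := by
  induction h with
  | refl => exact hx
  | tail _ h ih =>
    intro M hM hJ hy
    by_contra hcon
    push Not at hcon
    rcases h with h | h
    · rcases h with ⟨u, v, k, c, hk, hc'⟩ | ⟨u, v, k, c, hk, hc'⟩
      · obtain ⟨i, hi, hi'⟩ := ih M hM hJ hy
        apply hi'
        have := hcon i hi
        by_cases hik : i = k
        · subst hik
          simp only [Function.update_self] at this
          exact (M.add_mem_iff_left (M.mul_mem_left c hy)).1 this
        · simpa [hik] using this
      · have h1 := hcon k hk
        have h2 : u ∈ M := (M.add_mem_iff_left (M.mul_mem_left c h1)).1 hy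
        obtain ⟨i, hi, hi'⟩ := ih M hM hJ h2
        exact hi' (hcon i hi)
    · obtain ⟨i, hi, hi'⟩ := ih M hM hJ (by
        have := M.sub_mem hy (hJ h.1); simpa using this)
      apply hi'
      have := M.sub_mem (hcon i hi) (hJ (h.2 i hi)); simpa using this

/-- exact commutator -/
lemma reach_comm {u : A} {v : ι → A} {i j : ι} (hi : i ∈ S) (hj : j ∈ S) (hij : i ≠ j)
    {c : A} (hc : c ∈ p * q) :
    Reach J p q S (u, v) (u, Function.update v i (v i + c * v j)) := by
  induction hc using Submodule.mul_induction_on' generalizing v with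
  | mem_mul_mem a ha b hb =>
    have h1 : Reach J p q S (u, v) (u + b * v j, v) := reach_addu hj hb
    have h2 : Reach J p q S (u + b * v j, v) _ := reach_addv hi ha
    have h3 : Reach J p q S (u + b * v j, Function.update v i (v i + a * (u + b * v j)))
      (u, Function.update v i (v i + a * (u + b * v j))) := by
        refine reach_addu' hj (c := -b) (Ideal.mem_sup_left (q.neg_mem hb)) ?_
        rw [Function.update_of_ne hij.symm]
        convert J.zero_mem using 1; ring
    have h4 := reach_addv' (J := J) (q := q) (u := u)
      (v := Function.update v i (v i + a * (u + b * v j)))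
      (c := -a) (w := v i + a * b * v j) hi (Ideal.mem_sup_left (p.neg_mem ha)) (by
        rw [Function.update_self]; convert J.zero_mem using 1; ring)
    rw [Function.update_idem] at h4
    exact h1.trans (h2.trans (h3.trans h4))
  | add x hx y hy h1 h2 =>
    refine (h1 (v := v)).trans ?_
    have := h2 (v := Function.update v i (v i + x * v j))
    rw [Function.update_self, Function.update_of_ne hij.symm, Function.update_idem] at this
    have e : v i + (x + y) * v j = v i + x * v j + y * v j := by ring
    rw [e]; exact this

lemma reach_add {u : A} {v : ι → A} {i j : ι} (hi : i ∈ S) (hj : j ∈ S) (hij : i ≠ j)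
    (hI : Inv J p q S (u, v)) (c w : A) (hw : w - (v i + c * v j) ∈ J) :
    Reach J p q S (u, v) (u, Function.update v i w) := by
  obtain ⟨a, ha, b, hb, e⟩ := Submodule.mem_sup.1 hI.1
  simp only at e
  have h1 : Reach J p q S (u, v) _ :=
    reach_comm (v := v) (u := u) hi hj hij (c := -c * a) (Ideal.mul_mem_left _ _ ha)
  have h2 := reach_addv' (J := J) (q := q) (p := p) (u := u)
      (v := Function.update v i (v i + -c * a * v j))
      (c := c * v j) (w := w) hi (Ideal.mul_mem_left _ _ (hI.2 j hj)) (by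
        rw [Function.update_self]
        have := J.add_mem hw (J.mul_mem_left (-(c * v j)) hb)
        convert this using 1
        have : u = 1 + a + b := by rw [add_assoc, e]; ring
        rw [this]; ring)
  rw [Function.update_idem] at h2
  exact h1.trans h2

/-- clear all entries when `u = 1` -/
lemma reach_clear {u : A} {v : ι → A} (hu : u - 1 ∈ J) (hv : ∀ i ∈ S, v i ∈ p ⊔ J) :
    Reach J p q S (u, v) (1, 0) := by
  suffices H : ∀ T : Finset ι, T ⊆ S → ∃ v' : ι → A, Reach J p q S (u, v) (u, v') ∧
      (∀ i ∈ T, v' i ∈ J) ∧ ∀ i ∈ S, v' i ∈ p ⊔ J by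
    obtain ⟨v', h, h', -⟩ := H S subset_rfl
    refine h.trans (Cg.reach ⟨?_, fun i hi => by simpa using h' i hi⟩)
    rw [← neg_sub]; exact J.neg_mem hu
  intro T
  induction T using Finset.induction_on with
  | empty => exact fun _ => ⟨v, .refl, by simp, hv⟩
  | insert k T hk ih =>
    intro hT
    obtain ⟨v', h, h', h''⟩ := ih ((Finset.subset_insert _ _).trans hT)
    have hkS := hT (Finset.mem_insert_self k T)
    refine ⟨Function.update v' k 0, h.trans (reach_addv' (c := -v' k) hkS
      (Ideal.neg_mem_iff _ |>.2 (h'' k hkS)) ?_), ?_, ?_⟩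
    · have := J.mul_mem_left (v' k) hu
      convert this using 1; ring
    · intro i hi
      by_cases hik : i = k
      · subst hik; simp
      · simpa [hik] using h' i ((Finset.mem_insert.1 hi).resolve_left hik)
    · intro i hi
      by_cases hik : i = k
      · subst hik; simp
      · simpa [hik] using h'' i hi

lemma exists_of_forall_prime {I : Ideal A} (h : ∀ M : Ideal A, M.IsPrime → ¬ I ≤ M) : I = ⊤ := by
  by_contra hI
  obtain ⟨M, hM, hIM⟩ := Ideal.exists_le_maximal I hI
  exact h M hM.isPrime hIM

/-- `F0` -/
lemma reach_F0 {u : A} {v : ι → A} {i : ι} (hi : i ∈ S) (hu : u - 1 ∈ q ⊔ J) (c : A)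
    (hv : v i - 1 - c * u ∈ J) : Reach J ⊤ q S (u, v) (1, 0) := by
  have h1 := reach_addv' (J := J) (q := q) (p := ⊤) (u := u) (v := v) (c := -c) (w := 1) hi
    (by simp) (by convert J.neg_mem hv using 1; ring)
  have h2 := reach_addu' (J := J) (q := q) (p := ⊤) (u := u) (v := Function.update v i 1)
    (c := -(u - 1)) (w := 1) hi (Ideal.neg_mem_iff _ |>.2 hu) (by simp)
  exact h1.trans (h2.trans (reach_clear (by simp) (by simp)))

lemma reach_F1 {u : A} {v : ι → A} (hS : S.Nonempty) (hu : u - 1 ∈ q ⊔ J)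
    (hun : ∀ M : Ideal A, M.IsPrime → J ≤ M → u ∉ M) : Reach J ⊤ q S (u, v) (1, 0) := by
  obtain ⟨i, hi⟩ := hS
  have h : J ⊔ Ideal.span {u} = ⊤ := exists_of_forall_prime (fun M hM hle =>
    hun M hM (le_sup_left.trans hle) (hle (Ideal.mem_sup_right (Ideal.mem_span_singleton_self u))))
  have h1 := (Ideal.eq_top_iff_one _).1 h
  obtain ⟨j, hj, b, hb, e⟩ := Submodule.mem_sup.1 h1
  obtain ⟨b, rfl⟩ := Ideal.mem_span_singleton'.1 hb
  refine reach_F0 hi hu (b * (v i - 1)) ?_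
  have := J.mul_mem_right (v i - 1) hj
  convert this using 1
  have : j = 1 - b * u := by rw [← e]; ring
  rw [this]; ring

lemma reach_stepA {u : A} {v : ι → A} (C : A) {i j : ι} (hi : i ∈ S) (hj : j ∈ S)
    (hij : i ≠ j) (hI : Inv J p q S (u, v)) {c : A} (hc : c ∈ p) (v' : ι → A)
    (h1 : v' j = v j + c * (v i + C * u)) (h2 : ∀ l, l ≠ j → v' l = v l) :
    Reach J p q S (u, v) (u, v') := by
  have e : v' = Function.update v j (v j + c * (v i + C * u)) := by
    funext l
    by_cases hl : l = j
    · subst hl; simpa using h1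
    · simpa [hl] using h2 l hl
  rw [e]
  have a1 := reach_add (p := p) (q := q) hj hi hij.symm hI c (v j + c * v i) (by simp)
  have a2 := reach_addv' (J := J) (q := q) (p := p) (u := u)
    (v := Function.update v j (v j + c * v i)) (c := c * C) (i := j)
    (w := v j + c * (v i + C * u)) hj (Ideal.mem_sup_left (p.mul_mem_right _ hc)) (by
      rw [Function.update_self]; convert J.zero_mem using 1; ring)
  rw [Function.update_idem] at a2
  exact a1.trans a2

lemma reach_core1 {u : A} {v : ι → A} (C : A) {i j : ι} (hi : i ∈ S) (hj : j ∈ S)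
    (hij : i ≠ j) (hI : Inv J p q S (u, v)) {k k' : A} (hk : k ∈ p) (hk' : k' ∈ q) :
    Reach J p q S (u, v) (u + k' * k * (v i + C * u),
      Function.update v i (v i - C * (k' * k * (v i + C * u)))) := by
  set L := v i + C * u with hL
  set w := v j + k * L with hw
  have s1 : Reach J p q S (u, v) (u, Function.update v j w) :=
    reach_stepA C hi hj hij hI hk _ (by simp [hw, hL]) (fun l hl => by simp [hl])
  have s2 : Reach J p q S (u, Function.update v j w) (u + k' * w, Function.update v j w) := by
    have := reach_addu (J := J) (p := p) (u := u) (v := Function.update v j w) hj hk'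
    rwa [Function.update_self] at this
  have i2 := (s1.trans s2).inv hI
  have s3 := reach_add hi hj hij i2 (-(C * k')) (v i - C * k' * w) (by
    rw [Function.update_self, Function.update_of_ne hij]
    convert J.zero_mem using 1; ring)
  have i3 := s3.inv i2
  have s4 : Reach J p q S _ (u + k' * w, Function.update v i (v i - C * k' * w)) :=
    reach_stepA C hi hj hij i3 (c := -k) (p.neg_mem hk) _ (by
      simp [hij.symm, hw, hL]; ring) (fun l hl => by
      by_cases hl' : l = i
      · subst hl'; simp
      · simp [hl, hl'])
  have i4 := s4.inv i3
  have s5 : Reach J p q S (u + k' * w, Function.update v i (v i - C * k' * w))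
      (u + k' * k * L, Function.update v i (v i - C * k' * w)) := by
    refine reach_addu' hj (c := -k') (Ideal.mem_sup_left (q.neg_mem hk')) ?_
    rw [Function.update_of_ne hij.symm]
    convert J.zero_mem using 1; rw [hw]; ring
  have i5 := s5.inv i4
  have s6 := reach_add hi hj hij i5 (C * k') (v i - C * (k' * k * L)) (by
    rw [Function.update_self, Function.update_of_ne hij.symm]
    convert J.zero_mem using 1; rw [hw]; ring)
  rw [Function.update_idem] at s6
  exact s1.trans (s2.trans (s3.trans (s4.trans (s5.trans s6))))

lemma reach_core {u : A} {v : ι → A} (C : A) {i j : ι} (hi : i ∈ S) (hj : j ∈ S)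
    (hij : i ≠ j) (hI : Inv J p q S (u, v)) {c : A} (hc : c ∈ q * p) :
    Reach J p q S (u, v) (u + c * (v i + C * u),
      Function.update v i (v i - C * (c * (v i + C * u)))) := by
  induction hc using Submodule.mul_induction_on' generalizing u v with
  | mem_mul_mem a ha b hb => exact reach_core1 C hi hj hij hI hb ha
  | add x hx y hy h1 h2 =>
    have a1 := h1 hI
    have a2 := h2 (a1.inv hI)
    rw [Function.update_self, Function.update_idem] at a2
    have a3 := a1.trans a2
    have e1 : u + (x + y) * (v i + C * u) = u + x * (v i + C * u) + y * (v i - C * (x * (v i + C * u)) +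
      C * (u + x * (v i + C * u))) := by ring
    have e2 : v i - C * ((x + y) * (v i + C * u)) = v i - C * (x * (v i + C * u)) - C * (y *
      (v i - C * (x * (v i + C * u)) + C * (u + x * (v i + C * u)))) := by ring
    rw [e1, e2]; exact a3

/-- transvections are simulated -/
lemma reach_transv {u : A} {v : ι → A} (C : ι → A) {i j : ι} (hi : i ∈ S) (hj : j ∈ S)
    (hij : i ≠ j) (hI : Inv J p q S (u, v)) {c : A} (hc : c ∈ q * p) :
    Reach J p q S (u, v) (u + c * (v i + C i * u), fun l => v l - C l * (c * (v i + C i * u))) := by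
  set L := v i + C i * u with hL
  have hcp : c ∈ p := Ideal.mul_le_right hc
  have H : ∀ T : Finset ι, T ⊆ S → i ∉ T →
      Reach J p q S (u, v) (u + c * L, fun l => if l ∈ insert i T then v l - C l * (c * L) else v l) := by
    intro T
    induction T using Finset.induction_on with
    | empty =>
      intro _ _
      have := reach_core (C i) hi hj hij hI hc
      convert this using 2
      funext l
      by_cases hl : l = i
      · subst hl; simp [hL]
      · simp [hl]
    | insert k T hk ih =>
      intro hT hiT
      have hki : i ≠ k := fun h => hiT (h ▸ Finset.mem_insert_self k T)
      have r1 := ih ((Finset.subset_insert _ _).trans hT) (fun h => hiT (Finset.mem_insert_of_mem h))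
      refine r1.trans (reach_stepA (C i) hi (hT (Finset.mem_insert_self k T)) hki (r1.inv hI)
        (c := - (C k * c)) (p.neg_mem (p.mul_mem_left _ hcp)) _ ?_ ?_)
      · simp only [Finset.mem_insert, hk, hki.symm, or_true, true_or, if_true, or_false, if_false]
        have : v i - C i * (c * L) + C i * (u + c * L) = L := by rw [hL]; ring
        rw [this]; ring
      · intro l hl
        simp [hl]
  refine (H (S.erase i) (Finset.erase_subset _ _) (by simp)).trans (Cg.reach ⟨by simp, fun l hl => ?_⟩)
  rw [Finset.insert_erase hi]
  simp [hl]

/-- simulation lemma -/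
lemma reach_sim (hS : ∀ i ∈ S, ∃ j ∈ S, i ≠ j) {x y : A × (ι → A)}
    (h : Reach J ⊤ (q * p) S x y) (C v : ι → A)
    (hv : ∀ i ∈ S, v i - (x.2 i - C i * x.1) ∈ J) (hI : Inv J p q S (x.1, v)) :
    ∃ C' v' : ι → A, Reach J p q S (x.1, v) (y.1, v') ∧ ∀ i ∈ S, v' i - (y.2 i - C' i * y.1) ∈ J := by
  induction h with
  | refl => exact ⟨C, v, .refl, hv⟩
  | tail _ h ih =>
    obtain ⟨C', v', hr, hv'⟩ := ih
    rcases h with h | h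
    · rcases h with ⟨u, w, k, c, hk, hc'⟩ | ⟨u, w, k, c, hk, hc'⟩
      · refine ⟨Function.update C' k (C' k + c), v', hr, fun i hi => ?_⟩
        by_cases hik : i = k
        · subst hik
          simp only [Function.update_self]
          convert hv' i hi using 1; ring
        · simpa [hik] using hv' i hi
      · obtain ⟨j, hj, hkj⟩ := hS k hk
        have r1 := reach_transv C' hk hj hkj (hr.inv hI) hc'
        simp only at hv' r1
        refine ⟨C', _, hr.trans (r1.trans (Cg.reach (y := (u + c * w k, fun l => v' l - C' l * (c * (v' k + C' k * u)))) ⟨?_, fun i hi => by simp⟩)), ?_⟩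
        · simp only
          have := J.mul_mem_left (-c) (hv' k hk)
          convert this using 1; ring
        · intro i hi
          simp only
          have := J.add_mem (hv' i hi) (J.mul_mem_left (-(C' i * c)) (hv' k hk))
          convert this using 1; ring
    · refine ⟨C', v', hr.trans (Cg.reach ⟨h.1, fun i hi => by simp⟩), fun i hi => ?_⟩
      have := J.sub_mem (J.add_mem (hv' i hi) (J.mul_mem_left (C' i) h.1)) (h.2 i hi)
      convert this using 1; ring

lemma reach_sim_one (hS : ∀ i ∈ S, ∃ j ∈ S, i ≠ j) {u : A} {w : ι → A}
    (h : Reach J ⊤ (q * p) S (u, w) (1, 0)) (C v : ι → A)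
    (hv : ∀ i ∈ S, v i - (w i - C i * u) ∈ J) (hI : Inv J p q S (u, v)) :
    Reach J p q S (u, v) (1, 0) := by
  obtain ⟨C', v', hr, -⟩ := reach_sim hS h C v hv hI
  exact hr.trans (reach_clear (by simp) (hr.inv hI).2)

end generic
end Um3

namespace Um3
section dim
variable {R : Type*} [CommRing R]

/-- the quotient by `I` has dimension `< n` -/
def KD (I : Ideal R) (n : ℕ) : Prop :=
  ∀ l : LTSeries (PrimeSpectrum R), I ≤ l.head.asIdeal → l.length < n

lemma KD.zero {I : Ideal R} (h : KD I 0) : I = ⊤ := by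
  refine exists_of_forall_prime (fun M hM hle => ?_)
  exact absurd (h (RelSeries.singleton _ ⟨M, hM⟩) hle) (by simp)

lemma KD.mono {I I' : Ideal R} {n n' : ℕ} (h : KD I n) (hn : n ≤ n') (hI : I ≤ I') : KD I' n' :=
  fun l hl => (h l (hI.trans hl)).trans_le hn

lemma KD.bot {d : ℕ} (h : ringKrullDim R = d) : KD (⊥ : Ideal R) (d + 1) := by
  intro l _
  have := Order.LTSeries.length_le_krullDim l
  change _ ≤ ringKrullDim R at this
  rw [h] at this
  have : l.length ≤ d := by exact_mod_cast this
  omega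

lemma KD.step {I I' : Ideal R} {n : ℕ} (h : KD I (n + 1)) (hI : I ≤ I')
    (hm : ∀ M ∈ I.minimalPrimes, ¬ I' ≤ M) : KD I' n := by
  intro l hl
  have := l.head.isPrime
  obtain ⟨M, hM, hle⟩ := Ideal.exists_minimalPrimes_le (hI.trans hl)
  have hlt : (⟨M, hM.1.1⟩ : PrimeSpectrum R) < l.head := by
    refine lt_of_le_of_ne hle (fun e => hm M hM ?_)
    rw [← e] at hl; exact hl
  have := h (l.cons ⟨M, hM.1.1⟩ hlt) (by simpa using hM.1.2)
  simp at this
  omega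

lemma KD.radical {I : Ideal R} {n : ℕ} (h : KD I n) : KD I.radical n := h.mono le_rfl Ideal.le_radical

/-- use (1) -/
lemma KD.step1 {I I' : Ideal R} {n : ℕ} (h : KD I (n + 1)) (hr : I.IsRadical) (hI : I ≤ I') (a : R)
    (ha : a ∈ I'.radical) (hc : ∀ s, s * a ∈ I → s ∈ I'.radical) : KD I' n := by
  refine h.step hI (fun M hM hle => ?_)
  have hMp := hM.1.1
  have hle' : I'.radical ≤ M := hMp.radical_le_iff.2 hle
  have haM := hle' ha
  obtain ⟨s, hs, k, hk⟩ : ∃ s, s ∉ M ∧ ∃ k : ℕ, s * a ^ k ∈ I := by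
    by_contra hcon
    push Not at hcon
    let T : Submonoid R := M.primeCompl ⊔ Submonoid.powers a
    have hdis : Disjoint (I : Set R) T := by
      rw [Set.disjoint_left]
      intro x hx hxT
      obtain ⟨s, hs, b, ⟨k, rfl⟩, rfl⟩ := Submonoid.mem_sup.1 hxT
      exact hcon s hs k hx
    obtain ⟨Q, hQ, hIQ, hd⟩ := Ideal.exists_le_prime_disjoint I T hdis
    have hQM : Q ≤ M := by
      intro x hx
      by_contra hxM
      exact Set.disjoint_left.1 hd hx (le_sup_left (a := M.primeCompl) hxM)
    have := hM.2 ⟨hQ, hIQ⟩ hQM haM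
    exact Set.disjoint_left.1 hd this (le_sup_right (a := M.primeCompl) (Submonoid.mem_powers a))
  have h1 : s * a ∈ I := by
    apply hr
    refine ⟨k + 1, ?_⟩
    have : (s * a) ^ (k + 1) = s * a ^ k * (s ^ k * a) := by ring
    rw [this]; exact I.mul_mem_right _ hk
  exact hs (hle' (hc s h1))

/-- use (2) -/
lemma KD.step2 {I : Ideal R} {n : ℕ} (h : KD I (n + 1)) (t : R)
    (ht : ∀ s, s * t ∈ I → s ∈ I) (N : ℕ) : KD (I ⊔ Ideal.span {t ^ N}) n := by
  refine h.step le_sup_left (fun M hM hle => ?_)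
  have hMp := hM.1.1
  have haM : t ∈ M := hMp.mem_of_pow_mem N
    (hle (Ideal.mem_sup_right (Ideal.mem_span_singleton_self _)))
  obtain ⟨s, hs, k, hk⟩ : ∃ s, s ∉ M ∧ ∃ k : ℕ, s * t ^ k ∈ I := by
    by_contra hcon
    push Not at hcon
    let T : Submonoid R := M.primeCompl ⊔ Submonoid.powers t
    have hdis : Disjoint (I : Set R) T := by
      rw [Set.disjoint_left]
      intro x hx hxT
      obtain ⟨s, hs, b, ⟨k, rfl⟩, rfl⟩ := Submonoid.mem_sup.1 hxT
      exact hcon s hs k hx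
    obtain ⟨Q, hQ, hIQ, hd⟩ := Ideal.exists_le_prime_disjoint I T hdis
    have hQM : Q ≤ M := by
      intro x hx
      by_contra hxM
      exact Set.disjoint_left.1 hd hx (le_sup_left (a := M.primeCompl) hxM)
    have := hM.2 ⟨hQ, hIQ⟩ hQM haM
    exact Set.disjoint_left.1 hd this (le_sup_right (a := M.primeCompl) (Submonoid.mem_powers t))
  refine hs (hM.1.2 ?_)
  clear * - ht hk
  induction k with
  | zero => simpa using hk
  | succ k ih => exact ih (ht _ (by rwa [mul_assoc, ← pow_succ]))

/-- pseudo-division -/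
lemma pseudo_div (m : ℕ) (g : R[X]) (hg : g.degree < (m + 1 : ℕ)) (z : R[X]) :
    ∃ (k : ℕ) (Q ρ : R[X]), C (g.coeff m) ^ k * z = Q * g + ρ ∧ ρ.degree < m := by
  suffices H : ∀ (n : ℕ) (z : R[X]), z.degree < n → ∃ (k : ℕ) (Q ρ : R[X]),
      C (g.coeff m) ^ k * z = Q * g + ρ ∧ ρ.degree < m by
    exact H (z.natDegree + 1) z (degree_le_natDegree.trans_lt (by exact_mod_cast Nat.lt_succ_self _))
  intro n
  induction n with
  | zero =>
    intro z hz
    have : z = 0 := by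
      rw [← degree_eq_bot]
      exact Nat.WithBot.lt_zero_iff.1 (by simpa using hz)
    exact ⟨0, 0, 0, by simp [this], by simp⟩
  | succ n ih =>
    intro z hz
    by_cases hn : n < m
    · exact ⟨0, 0, z, by simp, hz.trans_le (by exact_mod_cast hn)⟩
    push Not at hn
    set z' := C (g.coeff m) * z - C (z.coeff n) * X ^ (n - m) * g with hz'
    have hd : z'.degree < n := by
      rw [degree_lt_iff_coeff_zero]
      intro j hj
      rw [hz', coeff_sub, coeff_C_mul, mul_assoc, coeff_C_mul, coeff_X_pow_mul']
      rw [if_pos (by omega)]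
      rcases hj.eq_or_lt with rfl | hlt
      · rw [Nat.sub_sub_self hn]; ring
      · rw [(degree_lt_iff_coeff_zero _ _).1 hz j hlt,
          (degree_lt_iff_coeff_zero _ _).1 hg (j - (n - m)) (by omega)]; ring
    obtain ⟨k, Q, ρ, h1, h2⟩ := ih z' hd
    refine ⟨k + 1, Q + C (g.coeff m) ^ k * (C (z.coeff n) * X ^ (n - m)), ρ, ?_, h2⟩
    rw [hz'] at h1
    linear_combination h1

end dim
end Um3

namespace Um3
set_option linter.unusedSectionVars false
section generic2
variable {A : Type*} [CommRing A] {ι : Type*} [DecidableEq ι]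
variable {J p q : Ideal A} {S : Finset ι}

lemma Reach.inv_top {x y : A × (ι → A)} (h : Reach J ⊤ q S x y) (hx : x.1 - 1 ∈ q ⊔ J) :
    y.1 - 1 ∈ q ⊔ J := by
  have := (h.inv (p := ⊤) ⟨by simpa using hx, by simp⟩).1
  simpa using this

lemma EReach.inv_top {x y : A × (ι → A)} (h : EReach ⊤ q S x y) (hx : x.1 - 1 ∈ q ⊔ J) :
    y.1 - 1 ∈ q ⊔ J := (EReach.reach (J := J) h).inv_top hx

lemma not_mem_of_cong {M : Ideal A} (hM : M.IsPrime) {u : A} (h : u - 1 ∈ M) : u ∉ M := fun h' => by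
  have := M.sub_mem h' h
  rw [sub_sub_cancel] at this
  exact hM.ne_top ((Ideal.eq_top_iff_one _).2 this)

lemma mem_of_mk_eq {x y : A} (h : Ideal.Quotient.mk J x = Ideal.Quotient.mk J y) : x - y ∈ J :=
  Ideal.Quotient.eq.1 h

lemma mem_sup_mono {J' : Ideal A} (h : J ≤ J') {x : A} (hx : x ∈ q ⊔ J) : x ∈ q ⊔ J' :=
  (show q ⊔ J ≤ q ⊔ J' from sup_le_sup_left h _) hx

lemma degC_le (a : A) (g : A[X]) : (C a * g).degree ≤ g.degree := by
  rw [← smul_eq_C_mul]; exact degree_smul_le a g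

end generic2

section rel
variable {R : Type*} [CommRing R] {ι : Type*} [DecidableEq ι]

def Rel (R : Type*) [CommRing R] (ι : Type*) [DecidableEq ι] (n : ℕ) : Prop :=
  ∀ (I : Ideal R) (J : Ideal R[X]) (t : Ideal R) (S : Finset ι) (u : R[X]) (v : ι → R[X]),
    KD I n → I.map C ≤ J → S.card = n → u - 1 ∈ t.map C ⊔ J → Un J S (u, v) →
    Reach J ⊤ (t.map C) S (u, v) (1, 0)

def RelRad (R : Type*) [CommRing R] (ι : Type*) [DecidableEq ι] (n : ℕ) : Prop :=
  ∀ (I : Ideal R) (J : Ideal R[X]) (t : Ideal R) (S : Finset ι) (u : R[X]) (v : ι → R[X]),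
    I.IsRadical → KD I n → I.map C ≤ J → S.card = n → u - 1 ∈ t.map C ⊔ J → Un J S (u, v) →
    Reach J ⊤ (t.map C) S (u, v) (1, 0)

lemma rel_zero : Rel R ι 0 := by
  intro I J t S u v hI hIJ hS hu hun
  have h1 := hI.zero
  have : J = ⊤ := by
    rw [Ideal.eq_top_iff_one]; apply hIJ
    rw [h1, Ideal.map_top]; trivial
  subst this
  exact Cg.reach ⟨by simp, fun i hi => by simp⟩

lemma Un.mono {A : Type*} [CommRing A] {J J' : Ideal A} {S : Finset ι} {x : A × (ι → A)}
    (h : Un J S x) (hJ : J ≤ J') : Un J' S x := fun M hM hle hx => h M hM (hJ.trans hle) hx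

lemma rel_of_relRad {n : ℕ} (hn : 0 < n) (H : RelRad R ι n) : Rel R ι n := by
  intro I J t S u v hI hIJ hS hu hun
  have h1 := H I.radical (J ⊔ I.radical.map C) t S u v (Ideal.radical_isRadical I) hI.radical
    le_sup_right hS (mem_sup_mono le_sup_left hu) (hun.mono le_sup_left)
  obtain ⟨⟨u', v'⟩, h2, h3⟩ := h1.extract
  refine h2.reach.trans (reach_F1 (Finset.card_pos.1 (hS ▸ hn)) (h2.inv_top hu) ?_)
  intro M hM hJ
  refine not_mem_of_cong hM ?_
  have hle : J ⊔ I.radical.map C ≤ M := by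
    refine sup_le hJ (Ideal.map_le_iff_le_comap.2 ?_)
    intro s ⟨k, hk⟩
    refine hM.mem_of_pow_mem k ?_
    rw [← C_pow]
    exact hJ (hIJ (Ideal.mem_map_of_mem C hk))
  have := M.neg_mem (hle h3.1)
  simpa using this

lemma relStar {n : ℕ} (hn : 0 < n) (H : Rel R ι n) {I : Ideal R} {J J0 : Ideal R[X]} {t : Ideal R}
    {S : Finset ι} {u : R[X]} {v : ι → R[X]} (hI : KD I n) (hIJ : I.map C ≤ J) (hS : S.card = n)
    (hJ0 : J0 ≤ J) (hu : u - 1 ∈ t.map C ⊔ J0) (hun : Un J S (u, v)) :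
    ∃ u' v', EReach ⊤ (t.map C) S (u, v) (u', v') ∧ u' - 1 ∈ t.map C * J ⊔ J0 := by
  have h1 := H I J t S u v hI hIJ hS (mem_sup_mono hJ0 hu) hun
  obtain ⟨⟨u', v'⟩, h2, h3⟩ := h1.extract
  have h4 : Reach (t.map C * J ⊔ J0) ⊤ (t.map C) S (u', v') (1, 0) := by
    have hu' : u' - 1 ∈ t.map C ⊔ J0 := h2.inv_top hu
    refine reach_F1 (Finset.card_pos.1 (hS ▸ hn)) (mem_sup_mono le_sup_right hu') ?_
    intro M hM hle
    refine not_mem_of_cong hM ?_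
    rcases hM.mul_le.1 (le_sup_left.trans hle) with h | h
    · exact (sup_le h (le_sup_right.trans hle)) hu'
    · have := M.neg_mem (h h3.1); simpa using this
  obtain ⟨⟨u'', v''⟩, h5, h6⟩ := h4.extract
  refine ⟨u'', v'', h2.trans h5, ?_⟩
  have := Ideal.neg_mem_iff _ |>.2 h6.1
  simpa using this

lemma exists_vnr {I : Ideal R} (hI : KD I 1) (hr : I.IsRadical) (a : R) : ∃ b, a - a * a * b ∈ I := by
  let c : Ideal R := Submodule.comap (LinearMap.mulRight R a) I
  have hc : ∀ s, s ∈ c ↔ s * a ∈ I := fun s => by simp [c]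
  have h1 : KD (I ⊔ (Ideal.span {a} ⊔ c)) 0 := by
    refine hI.step1 hr le_sup_left a (Ideal.le_radical ?_) (fun s hs => Ideal.le_radical ?_)
    · exact Ideal.mem_sup_right (Ideal.mem_sup_left (Ideal.mem_span_singleton_self a))
    · exact Ideal.mem_sup_right (Ideal.mem_sup_right ((hc s).2 hs))
  have h2 := (Ideal.eq_top_iff_one _).1 h1.zero
  obtain ⟨i, hi, z, hz, e⟩ := Submodule.mem_sup.1 h2
  obtain ⟨y, hy, w, hw, rfl⟩ := Submodule.mem_sup.1 hz
  obtain ⟨b, rfl⟩ := Ideal.mem_span_singleton'.1 hy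
  refine ⟨b, ?_⟩
  have := I.add_mem (I.mul_mem_right a hi) ((hc w).1 hw)
  convert this using 1
  linear_combination (-a) * e

lemma exists_idem {I : Ideal R} (H : ∀ a : R, ∃ b, a - a * a * b ∈ I) (t : Ideal R) (ν : R[X])
    (hν : ν ∈ t.map C) : ∃ e ∈ t, e * e - e ∈ I ∧ (1 - C e) * ν ∈ I.map C := by
  induction hν using Submodule.span_induction with
  | mem x hx =>
    obtain ⟨s, hs, rfl⟩ := hx
    obtain ⟨b, hb⟩ := H s
    refine ⟨s * b, t.mul_mem_right _ hs, ?_, ?_⟩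
    · have := I.mul_mem_right (-b) hb
      convert this using 1; ring
    · have := Ideal.mem_map_of_mem C hb
      convert this using 1
      simp only [C_sub, C_mul]; ring
  | zero => exact ⟨0, t.zero_mem, by simp, by simp⟩
  | add x y _ _ hx hy =>
    obtain ⟨e1, h1, h2, h3⟩ := hx
    obtain ⟨e2, k1, k2, k3⟩ := hy
    refine ⟨e1 + e2 - e1 * e2, t.sub_mem (t.add_mem h1 k1) (t.mul_mem_left _ k1), ?_, ?_⟩
    · have := I.add_mem (I.mul_mem_left ((1 - e1) * (1 - e1)) k2) (I.mul_mem_left (1 - e2) h2)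
      convert this using 1; ring
    · have := Ideal.add_mem _ (Ideal.mul_mem_left _ (1 - C e2) h3)
        (Ideal.mul_mem_left _ (1 - C e1) k3)
      convert this using 1
      simp only [C_sub, C_mul, C_add]; ring
  | smul a x _ hx =>
    obtain ⟨e1, h1, h2, h3⟩ := hx
    refine ⟨e1, h1, h2, ?_⟩
    have := Ideal.mul_mem_left _ a h3
    convert this using 1
    simp only [smul_eq_mul]; ring

lemma euclid {I : Ideal R} (H : ∀ a : R, ∃ b, a - a * a * b ∈ I) {J : Ideal R[X]} (hIJ : I.map C ≤ J)
    {t : Ideal R} {S : Finset ι} {i : ι} (hi : i ∈ S) (hS : ∀ j ∈ S, j = i) {e : R} (het : e ∈ t)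
    (m : ℕ) : ∀ (u : R[X]) (v : ι → R[X]) (g : R[X]), u - 1 ∈ t.map C ⊔ J → Un J S (u, v) →
      g.degree < m → v i - C e * g ∈ J → Reach J ⊤ (t.map C) S (u, v) (1, 0) := by
  induction m with
  | zero =>
    intro u v g hu hun hg hv
    have hg0 : g = 0 := by
      rw [← degree_eq_bot]
      exact Nat.WithBot.lt_zero_iff.1 (by simpa using hg)
    subst hg0
    refine reach_F1 ⟨i, hi⟩ hu (fun M hM hJ hm => ?_)
    obtain ⟨j, hj, hj'⟩ := hun M hM hJ hm
    rw [hS j hj] at hj'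
    exact hj' (hJ (by simpa using hv))
  | succ m ih =>
    intro u v g hu hun hg hv
    set s := g.coeff m with hs
    obtain ⟨b, hb⟩ := H (e * s)
    obtain ⟨k, Q, ρ, h1, h2⟩ := pseudo_div m (C e * g)
      ((degC_le e g).trans_lt hg) u
    rw [coeff_C_mul, ← hs] at h1
    set f := e * s * b with hf
    have hft : f ∈ t := t.mul_mem_right _ (t.mul_mem_right _ het)
    have hfC : ∀ y : R[X], C f * y ∈ t.map C ⊔ J := fun y =>
      Ideal.mem_sup_left (Ideal.mul_mem_right _ _ (Ideal.mem_map_of_mem C hft))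
    set w1 := u - C f * C b ^ k * Q * v i with hw1
    set v1 := v i + C f * w1 with hv1
    set w2 := w1 - C f * v1 with hw2
    set v2 := v1 + C f * w2 with hv2
    have r1 : Reach J ⊤ (t.map C) S (u, v) (w1, v) :=
      reach_addu' hi (c := -(C f * (C b ^ k * Q))) (Ideal.neg_mem_iff _ |>.2 (hfC _))
        (by convert J.zero_mem using 1; rw [hw1]; ring)
    have r2 : Reach J ⊤ (t.map C) S (w1, v) (w1, Function.update v i v1) :=
      reach_addv' hi (c := C f) (by simp) (by simp [hv1])
    have r3 : Reach J ⊤ (t.map C) S (w1, Function.update v i v1) (w2, Function.update v i v1) :=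
      reach_addu' hi (c := -(C f * 1)) (Ideal.neg_mem_iff _ |>.2 (hfC _))
        (by rw [Function.update_self]; convert J.zero_mem using 1; rw [hw2]; ring)
    have r4 := reach_addv' (J := J) (p := ⊤) (q := t.map C) (S := S) (u := w2)
      (v := Function.update v i v1) (w := v2) hi (c := C f) (by simp) (by simp [hv2])
    rw [Function.update_idem] at r4
    have r := r1.trans (r2.trans (r3.trans r4))
    refine r.trans (ih _ _ (C (1 - f) * (g - C s * X ^ m) + C (s * b ^ (k + 1)) * ρ)
      (r.inv_top hu) (r.un hun) ?_ ?_)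
    · refine (degree_add_le _ _).trans_lt (max_lt ((degC_le _ _).trans_lt ?_)
        ((degC_le _ _).trans_lt h2))
      rw [degree_lt_iff_coeff_zero]
      intro j hj
      rw [coeff_sub, coeff_C_mul, coeff_X_pow]
      rcases hj.eq_or_lt with rfl | hlt
      · simp [hs]
      · rw [if_neg (by omega), (degree_lt_iff_coeff_zero _ _).1 hg j hlt]; simp
    · rw [Function.update_self]
      apply mem_of_mk_eq
      have q1 : Ideal.Quotient.mk J (C (e * s)) * (1 - Ideal.Quotient.mk J (C f)) = 0 := by
        rw [← map_one (Ideal.Quotient.mk J), ← map_sub, ← map_mul, Ideal.Quotient.eq_zero_iff_mem]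
        apply hIJ
        have := Ideal.mem_map_of_mem C hb
        convert this using 1
        simp only [hf, C_sub, C_mul]; ring
      have q2 := Ideal.Quotient.eq.2 hv
      have q3 := congrArg (Ideal.Quotient.mk J) h1
      simp only [hv2, hw2, hv1, hw1, hf, map_add, map_sub, map_mul, map_pow, map_one] at q1 q2 q3 ⊢
      generalize Ideal.Quotient.mk J (C e) = E at *
      generalize Ideal.Quotient.mk J (C s) = s' at *
      generalize Ideal.Quotient.mk J (C b) = B at *
      generalize Ideal.Quotient.mk J u = U at *
      generalize Ideal.Quotient.mk J g = G at *
      generalize Ideal.Quotient.mk J (v i) = V at *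
      generalize Ideal.Quotient.mk J Q = Q' at *
      generalize Ideal.Quotient.mk J ρ = ρ' at *
      generalize Ideal.Quotient.mk J X = X' at *
      set F := E * s' * B with hF
      have q4 : F * F = F := by rw [hF]; linear_combination (-B) * q1
      have q5 : F * ((E * s') ^ k * B ^ k) = F := by
        rw [← mul_pow, ← hF]
        have : IsIdempotentElem F := q4
        rw [← pow_succ', this.pow_succ_eq]
      have q6 : F * (U - F * B ^ k * Q' * V) = F * B ^ k * ρ' := by
        rw [q2, mul_pow] at *
        linear_combination (-(B ^ k * Q' * (E * G))) * q4 - U * q5 + F * B ^ k * q3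
      have q7 : V + F * (U - F * B ^ k * Q' * V) + F * (U - F * B ^ k * Q' * V - F * (V + F * (U - F * B ^ k * Q' * V)))
        = (1 - F) * V + F * B ^ k * ρ' := by
        linear_combination q6 + (-V + (-F - 1) * (U - F * B ^ k * Q' * V)) * q4
      rw [q7, q2]
      linear_combination X' ^ m * q1 
      
lemma relRad_one : RelRad R ι 1 := by
  intro I J t S u v hr hI hIJ hS hu hun
  obtain ⟨i, rfl⟩ := Finset.card_eq_one.1 hS
  have H := exists_vnr hI hr
  obtain ⟨ν, hν, j, hj, e0⟩ := Submodule.mem_sup.1 hu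
  obtain ⟨e, h1, h2, h3⟩ := exists_idem H t ν hν
  have hi : i ∈ ({i} : Finset ι) := by simp
  have r1 := reach_addv' (J := J) (p := ⊤) (q := t.map C) (S := {i}) (u := u)
    (v := v) (w := C e * v i) hi (c := -((1 - C e) * v i)) (by simp) (by
      have := J.add_mem (J.mul_mem_right (v i) (hIJ h3)) (J.mul_mem_left ((1 - C e) * v i) hj)
      convert this using 1
      linear_combination (-(1 - C e) * v i) * e0)
  refine r1.trans (euclid H hIJ hi (by simp) h1 ((v i).natDegree + 1) _ _ (v i) (r1.inv_top hu)
    (r1.un hun) (degree_le_natDegree.trans_lt (by exact_mod_cast Nat.lt_succ_self _)) (by simp))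

end rel
end Um3

namespace Um3
set_option linter.unusedSectionVars false
section generic3
variable {A : Type*} [CommRing A] {ι : Type*} [DecidableEq ι]
variable {J p q : Ideal A} {S : Finset ι}

lemma reach_scale (u : A) (w c : ι → A) :
    Reach J ⊤ q S (u, w) (u, fun i => w i + c i * u) := by
  have H : ∀ T : Finset ι, T ⊆ S →
      Reach J ⊤ q S (u, w) (u, fun i => if i ∈ T then w i + c i * u else w i) := by
    intro T
    induction T using Finset.induction_on with
    | empty => intro _; exact Cg.reach ⟨by simp, by simp⟩
    | insert k T hk ih =>
      intro hT
      refine (ih ((Finset.subset_insert _ _).trans hT)).trans ?_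
      have := reach_addv (J := J) (p := ⊤) (q := q) (u := u)
        (v := fun i => if i ∈ T then w i + c i * u else w i)
        (hT (Finset.mem_insert_self k T)) (c := c k) (by simp)
      convert this using 2
      funext l
      by_cases hl : l = k
      · subst hl; simp [hk]
      · simp [hl]
  refine (H S subset_rfl).trans (Cg.reach ⟨by simp, fun i hi => by simp [hi]⟩)

lemma reach_sum {u : A} {v : ι → A} (hu : u - 1 ∈ q ⊔ J) {i : ι} (hi : i ∈ S) (c : ι → A) :
    Reach J ⊤ q S (u, v) (u, Function.update v i (v i + ∑ j ∈ S.erase i, c j * v j)) := by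
  have H : ∀ T : Finset ι, T ⊆ S.erase i →
      Reach J ⊤ q S (u, v) (u, Function.update v i (v i + ∑ j ∈ T, c j * v j)) := by
    intro T
    induction T using Finset.induction_on with
    | empty => intro _; simp only [Finset.sum_empty, add_zero, Function.update_eq_self]; exact .refl
    | insert k T hk ih =>
      intro hT
      have r1 := ih ((Finset.subset_insert _ _).trans hT)
      have hk' := Finset.mem_erase.1 (hT (Finset.mem_insert_self k T))
      have r2 := reach_add (J := J) (p := ⊤) (q := q) (u := u)
        (v := Function.update v i (v i + ∑ j ∈ T, c j * v j)) hi hk'.2 hk'.1.symm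
        ⟨by simpa using r1.inv_top hu, by simp⟩ (c k) (v i + ∑ j ∈ insert k T, c j * v j) (by
          rw [Function.update_self, Function.update_of_ne hk'.1, Finset.sum_insert hk]
          convert J.zero_mem using 1; ring)
      rw [Function.update_idem] at r2
      exact r1.trans r2
  exact H _ subset_rfl

lemma reach_D0 {u : A} {v : ι → A} (hu : u - 1 ∈ q ⊔ J) {i : ι} (hi : i ∈ S)
    (hun : Un J S (u, v)) (hv : v i ∈ J) : Reach J ⊤ q S (u, v) (1, 0) := by
  have h1 : J ⊔ (Ideal.span {u} ⊔ Ideal.span (Set.image v (S.erase i : Finset ι))) = ⊤ := by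
    refine exists_of_forall_prime (fun M hM hle => ?_)
    have hJ : J ≤ M := le_sup_left.trans hle
    obtain ⟨k, hk, hk'⟩ := hun M hM hJ (hle (Ideal.mem_sup_right
      (Ideal.mem_sup_left (Ideal.mem_span_singleton_self u))))
    by_cases hki : k = i
    · subst hki; exact hk' (hJ hv)
    · exact hk' (hle (Ideal.mem_sup_right (Ideal.mem_sup_right (Ideal.subset_span
        ⟨k, by simp [hki, hk], rfl⟩))))
  have h2 := (Ideal.eq_top_iff_one _).1 h1
  obtain ⟨j, hj, z, hz, e⟩ := Submodule.mem_sup.1 h2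
  obtain ⟨y, hy, x, hx, rfl⟩ := Submodule.mem_sup.1 hz
  obtain ⟨b, rfl⟩ := Ideal.mem_span_singleton'.1 hy
  obtain ⟨c, rfl⟩ := (Submodule.mem_span_image_finset_iff_exists_fun' A).1 hx
  have r1 := reach_sum (J := J) (q := q) (u := u) (v := v) hu hi c
  refine r1.trans (reach_F0 hi (r1.inv_top hu) (-b) ?_)
  rw [Function.update_self]
  have := J.sub_mem hv hj
  convert this using 1
  simp only [smul_eq_mul] at e
  linear_combination e

end generic3

section rel
variable {R : Type*} [CommRing R] {ι : Type*} [DecidableEq ι]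

lemma reach_P {J q : Ideal R[X]} {S : Finset ι} {u : R[X]} {v : ι → R[X]} (hu : u - 1 ∈ q ⊔ J)
    {i1 i2 : ι} (h1 : i1 ∈ S) (h2 : i2 ∈ S) (h12 : i1 ≠ i2) {m : ℕ} {g b : R[X]}
    (hg : g.degree < (m + 1 : ℕ)) (hv : v i1 - g ∈ J) (hb : C (g.coeff m) * b - 1 + u ∈ J) :
    ∃ (v' : ι → R[X]) (ρ : R[X]), Reach J ⊤ q S (u, v) (u, v') ∧ ρ.degree < m ∧ v' i1 - ρ ∈ J := by
  obtain ⟨k, Q, ρ, e1, e2⟩ := pseudo_div m g hg (v i2)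
  set a : R[X] := C (g.coeff m) with ha
  obtain ⟨h, hh⟩ : ∃ h, (a * b) ^ k - 1 - h * u ∈ J := by
    obtain ⟨h, hh⟩ := sub_dvd_pow_sub_pow (1 - u) 1 k
    refine ⟨-h, ?_⟩
    rw [← Ideal.Quotient.eq_zero_iff_mem]
    have q1 : Ideal.Quotient.mk J (a * b) = Ideal.Quotient.mk J (1 - u) := by
      rw [Ideal.Quotient.eq]; convert hb using 1; ring
    rw [map_sub, map_sub, map_pow, q1, ← map_pow, ← map_sub, ← map_sub]
    have : (1 - u) ^ k - 1 - -h * u = 0 := by linear_combination hh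
    rw [this, map_zero]
  set y2 := v i2 - b ^ k * Q * v i1 with hy2
  set y1 := v i1 + a ^ k * y2 with hy1
  set z2 := y2 - b ^ k * y1 with hz2
  set z1 := y1 + a ^ k * z2 with hz1
  have inv : ∀ {v : ι → R[X]}, Inv J ⊤ q S (u, v) := ⟨by simpa using hu, by simp⟩
  have r1 : Reach J ⊤ q S (u, v) (u, Function.update v i2 y2) :=
    reach_add h2 h1 h12.symm inv (-(b ^ k * Q)) _ (by
      convert J.zero_mem using 1; rw [hy2]; ring)
  have r2 := reach_add (v := Function.update v i2 y2) h1 h2 h12 inv (a ^ k) y1 (by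
      rw [Function.update_self, Function.update_of_ne h12]
      convert J.zero_mem using 1; rw [hy1]; ring)
  have r3 := reach_add (v := Function.update (Function.update v i2 y2) i1 y1) h2 h1 h12.symm inv (-b ^ k) z2 (by
      rw [Function.update_self, Function.update_of_ne h12.symm, Function.update_self]
      convert J.zero_mem using 1; rw [hz2]; ring)
  have r4 := reach_add (v := Function.update (Function.update (Function.update v i2 y2) i1 y1) i2 z2)
    h1 h2 h12 inv (a ^ k) z1 (by
      rw [Function.update_self, Function.update_of_ne h12, Function.update_self]
      convert J.zero_mem using 1; rw [hz1]; ring)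
  have r5 := reach_addv (J := J) (p := ⊤) (q := q) (u := u) (v := Function.update (Function.update
    (Function.update (Function.update v i2 y2) i1 y1) i2 z2) i1 z1) h1 (c := h * (Q * g + y1)) (by simp)
  refine ⟨_, ρ, r1.trans (r2.trans (r3.trans (r4.trans r5))), e2, ?_⟩
  rw [Function.update_self, Function.update_self]
  apply mem_of_mk_eq
  have q1 := Ideal.Quotient.eq.2 hv
  have q2 := congrArg (Ideal.Quotient.mk J) e1
  have q3 := Ideal.Quotient.eq.2 hh
  simp only [hz1, hz2, hy1, hy2, map_add, map_sub, map_mul, map_pow, map_one] at q1 q2 q3 ⊢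
  rw [mul_pow] at q3
  rw [q1]
  generalize Ideal.Quotient.mk J a = a' at *
  generalize Ideal.Quotient.mk J b = b' at *
  generalize Ideal.Quotient.mk J Q = Q' at *
  generalize Ideal.Quotient.mk J u = u' at *
  generalize Ideal.Quotient.mk J g = g' at *
  generalize Ideal.Quotient.mk J h = h' at *
  generalize Ideal.Quotient.mk J (v i2) = w' at *
  generalize Ideal.Quotient.mk J ρ = ρ' at *
  linear_combination q2 - (Q' * g' + g' + a' ^ k * (w' - b' ^ k * Q' * g')) * q3

/-- the inner induction claim -/
def DD (I : Ideal R) (S : Finset ι) (i1 : ι) (m : ℕ) : Prop :=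
  ∀ (J : Ideal R[X]) (t : Ideal R) (u : R[X]) (v : ι → R[X]) (g : R[X]), I.map C ≤ J →
    u - 1 ∈ t.map C ⊔ J → Un J S (u, v) → g.degree < m → v i1 - g ∈ J →
    Reach J ⊤ (t.map C) S (u, v) (1, 0)

lemma DD_zero (I : Ideal R) (S : Finset ι) (i1 : ι) (h1 : i1 ∈ S) : DD I S i1 0 := by
  intro J t u v g hIJ hu hun hg hv
  have hg0 : g = 0 := by
    rw [← degree_eq_bot]
    exact Nat.WithBot.lt_zero_iff.1 (by simpa using hg)
  subst hg0
  exact reach_D0 hu h1 hun (by simpa using hv)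

/-- preparation step -/
lemma prep {n : ℕ} (hn : 0 < n) (H : Rel R ι n) {I d : Ideal R} (hKD : KD (I ⊔ d) n) {S : Finset ι}
    (hS : S.card = n + 1) {i1 : ι} (h1 : i1 ∈ S) {J : Ideal R[X]} {t : Ideal R} {u : R[X]}
    {v : ι → R[X]} (hIJ : I.map C ≤ J) (hu : u - 1 ∈ t.map C ⊔ J) (hun : Un J S (u, v)) :
    ∃ u' v', Reach J ⊤ (t.map C) S (u, v) (u', v') ∧ v' i1 = v i1 ∧ u' - 1 ∈ (t * d).map C ⊔ J := by
  set q := t.map (C : R →+* R[X]) with hq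
  set J0 := J ⊔ q * Ideal.span {v i1} with hJ0
  set J' := J0 ⊔ (I ⊔ d).map C with hJ'
  have hun' : Un J' (S.erase i1) (u, v) := by
    intro M hM hle hm
    have hJM : J ≤ M := le_sup_left.trans (le_sup_left.trans hle)
    obtain ⟨i, hi, hi'⟩ := hun M hM hJM hm
    by_cases hi1 : i = i1
    · subst hi1
      exfalso
      have h3 : q * Ideal.span {v i} ≤ M := le_sup_right.trans (le_sup_left.trans hle)
      rcases hM.mul_le.1 h3 with h | h
      · exact not_mem_of_cong hM (sup_le h hJM hu) hm
      · exact hi' (h (Ideal.mem_span_singleton_self _))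
    · exact ⟨i, Finset.mem_erase.2 ⟨hi1, hi⟩, hi'⟩
  obtain ⟨u', v', r1, h2⟩ := relStar hn H (J0 := J0) (t := t) hKD (le_sup_right : _ ≤ J')
    (by rw [Finset.card_erase_of_mem h1, hS]; rfl) le_sup_left (mem_sup_mono le_sup_left hu) hun'
  have hv1 : v' i1 = v i1 := r1.off (by simp)
  have h3 : q * J' ⊔ J0 ≤ ((t * d).map C ⊔ J) ⊔ q * Ideal.span {v i1} := by
    refine sup_le ?_ ?_
    · rw [hJ', Ideal.mul_sup q J0, hq, ← Ideal.map_mul, Ideal.mul_sup t I d, Ideal.map_sup]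
      refine sup_le ?_ (sup_le ?_ ?_)
      · refine Ideal.mul_le_right.trans ?_
        exact sup_le (le_sup_right.trans le_sup_left) le_sup_right
      · exact (Ideal.map_mono Ideal.mul_le_right).trans (hIJ.trans (le_sup_right.trans le_sup_left))
      · exact le_sup_left.trans le_sup_left
    · exact sup_le (le_sup_right.trans le_sup_left) le_sup_right
  obtain ⟨x, hx, y, hy, e⟩ := Submodule.mem_sup.1 (h3 h2)
  obtain ⟨c, hc, rfl⟩ := Ideal.mem_mul_span_singleton.1 hy
  refine ⟨u' - c * v i1, v', ((r1.mono le_rfl le_rfl (Finset.erase_subset _ _)).reach).trans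
    (reach_addu' h1 (c := -c) (Ideal.mem_sup_left (q.neg_mem hc)) ?_), hv1, ?_⟩
  · rw [hv1]; convert J.zero_mem using 1; ring
  · convert hx using 1
    linear_combination -e

lemma piece {t c : Ideal R} {J : Ideal R[X]} {S : Finset ι} (hS : ∀ i ∈ S, ∃ j ∈ S, i ≠ j)
    {u : R[X]} {w : ι → R[X]} (hu : u - 1 ∈ (t * c * c).map C ⊔ J)
    (h : Reach J ⊤ ((t * c * c).map C) S (u, w) (1, 0)) :
    Reach J (c.map C) ((t * c).map C) S (u, fun i => w i + -w i * u) (1, 0) := by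
  rw [Ideal.map_mul] at h hu
  refine reach_sim_one hS h w _ (fun i hi => ?_) ⟨?_, fun i hi => ?_⟩
  · convert J.zero_mem using 1; ring
  · rwa [mul_comm (c.map C)]
  · have := Ideal.mul_mem_left _ (-w i) ((sup_le_sup_right (Ideal.mul_le_right) J :
      (t * c).map C * c.map C ⊔ J ≤ c.map C ⊔ J) hu)
    convert this using 1; ring

lemma DD_succ {n : ℕ} (hn : 0 < n) (H : Rel R ι n) {I : Ideal R} (hr : I.IsRadical)
    (hI : KD I (n + 1)) {S : Finset ι} (hS : S.card = n + 1) {i1 : ι} (h1 : i1 ∈ S) {m : ℕ}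
    (hm : DD I S i1 m) : DD I S i1 (m + 1) := by
  intro J t u v g hIJ hu hun hg hv
  have hS2 : ∀ i ∈ S, ∃ j ∈ S, i ≠ j := by
    intro i hi
    obtain ⟨j, hj, hji⟩ := Finset.exists_mem_ne (by omega : 1 < S.card) i
    exact ⟨j, hj, hji.symm⟩
  set a := g.coeff m with ha
  set I2 : Ideal R := Submodule.comap (LinearMap.mulRight R a) I with hI2
  have hc : ∀ s, s ∈ I2 ↔ s * a ∈ I := fun s => by simp [hI2]
  set sa : Ideal R := Ideal.span {a} with hsa
  have haa : a ∈ sa := Ideal.mem_span_singleton_self a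
  have hKD : KD (I ⊔ (sa * sa ⊔ I2 * I2)) n := by
    refine hI.step1 hr le_sup_left a ⟨2, ?_⟩ (fun s hs => ⟨2, ?_⟩)
    · rw [pow_two]
      exact Ideal.mem_sup_right (Ideal.mem_sup_left (Ideal.mul_mem_mul haa haa))
    · rw [pow_two]
      have := (hc s).2 hs
      exact Ideal.mem_sup_right (Ideal.mem_sup_right (Ideal.mul_mem_mul this this))
  obtain ⟨u1, w, r1, hw, hu1⟩ := prep hn H hKD hS h1 hIJ hu hun
  have hun1 := r1.un hun
  have hwg : w i1 - g ∈ J := by rwa [hw]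
  have hu1q := r1.inv_top hu
  have r2 := reach_scale (J := J) (q := t.map C) (S := S) u1 w (fun i => - w i)
  refine (r1.trans r2).trans ?_
  have hmapsup : (t * (sa * sa ⊔ I2 * I2)).map (C : R →+* R[X]) =
      (t * sa * sa).map C ⊔ (t * I2 * I2).map C := by
    rw [Ideal.mul_sup, Ideal.map_sup, mul_assoc, mul_assoc]
  rw [hmapsup] at hu1
  -- piece 1
  have k1 : Reach (J ⊔ sa.map C) (I2.map C) ((t * I2).map C) S (u1, fun i => w i + -w i * u1) (1, 0) := by
    have hle : (t * sa * sa).map C ⊔ (t * I2 * I2).map C ⊔ J ≤ (t * I2 * I2).map C ⊔ (J ⊔ sa.map C) := by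
      refine sup_le (sup_le ?_ le_sup_left) (le_sup_left.trans le_sup_right)
      exact (Ideal.map_mono Ideal.mul_le_right).trans (le_sup_right.trans le_sup_right)
    refine piece hS2 (hle hu1) (hm _ _ _ _ (g - C a * X ^ m) (hIJ.trans le_sup_left) (hle hu1)
      (hun1.mono le_sup_left) ?_ ?_)
    · rw [degree_lt_iff_coeff_zero]
      intro j hj
      rw [coeff_sub, coeff_C_mul, coeff_X_pow]
      rcases hj.eq_or_lt with rfl | hlt
      · simp [ha]
      · rw [if_neg (by omega), (degree_lt_iff_coeff_zero _ _).1 hg j hlt]; simp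
    · have := Ideal.add_mem _ (Ideal.mem_sup_left hwg : _ ∈ J ⊔ sa.map C)
        (Ideal.mem_sup_right (Ideal.mul_mem_right (X ^ m) _ (Ideal.mem_map_of_mem C haa)))
      convert this using 1; ring
  have k2 : Reach (J ⊔ I2.map C) (sa.map C) ((t * sa).map C) S (u1, fun i => w i + -w i * u1) (1, 0) := by
    have hle : (t * sa * sa).map C ⊔ (t * I2 * I2).map C ⊔ J ≤ (t * sa * sa).map C ⊔ (J ⊔ I2.map C) := by
      refine sup_le (sup_le le_sup_left ?_) (le_sup_left.trans le_sup_right)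
      exact (Ideal.map_mono Ideal.mul_le_right).trans (le_sup_right.trans le_sup_right)
    refine piece hS2 (hle hu1) ?_
    obtain ⟨i2, hi2, h12⟩ := hS2 i1 h1
    obtain ⟨x, hx, y, hy, e⟩ := Submodule.mem_sup.1 (hle hu1)
    have hx' : x ∈ Ideal.span {(C a : R[X])} := by
      have := (Ideal.map_mono Ideal.mul_le_right : (t * sa * sa).map C ≤ sa.map C) hx
      rwa [hsa, Ideal.map_span, Set.image_singleton] at this
    obtain ⟨b, rfl⟩ := Ideal.mem_span_singleton'.1 hx'
    obtain ⟨v', ρ, r3, hρ, hv'⟩ := reach_P (J := J ⊔ I2.map C) (hle hu1) h1 hi2 h12 (b := -b) hg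
      (Ideal.mem_sup_left hwg) (by
        rw [← ha]; convert hy using 1
        linear_combination -e)
    exact r3.trans (hm _ _ _ _ ρ (hIJ.trans le_sup_left) (hle hu1)
      (r3.un (hun1.mono le_sup_left)) hρ hv')
  obtain ⟨y, e1, c1⟩ := k1.extract
  have c2 : Cg (J ⊔ I2.map C) S _ y := e1.cg le_sup_right
    ((Ideal.map_mono Ideal.mul_le_right).trans le_sup_right)
  obtain ⟨z, e2, c3⟩ := (c2.symm.reach.trans k2).extract
  have c4 : Cg (J ⊔ sa.map C) S y z := e2.cg le_sup_right
    ((Ideal.map_mono Ideal.mul_le_right).trans le_sup_right)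
  have c5 := c4.symm.trans c1
  have e3 : EReach ⊤ (t.map C) S _ z := Relation.ReflTransGen.trans
    (e1.mono le_top (Ideal.map_mono Ideal.mul_le_left) subset_rfl)
    (e2.mono le_top (Ideal.map_mono Ideal.mul_le_left) subset_rfl)
  refine e3.reach.trans (reach_F1 ⟨i1, h1⟩ (e3.inv_top hu1q) (fun M hM hJ => not_mem_of_cong hM ?_))
  have hmul : sa.map C * I2.map C ≤ M := by
    rw [← Ideal.map_mul]
    refine (Ideal.map_mono ?_).trans (hIJ.trans hJ)
    rw [hsa, Ideal.span_singleton_mul_le_iff]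
    intro s hs
    have := (hc s).1 hs
    rwa [mul_comm] at this
  have key : z.1 - 1 ∈ M := by
    rw [← neg_sub]
    apply M.neg_mem
    rcases hM.mul_le.1 hmul with h | h
    · exact (sup_le hJ h) c5.1
    · exact (sup_le hJ h) c3.1
  exact key

theorem rel_all (n : ℕ) : Rel R ι n := by
  induction n with
  | zero => exact rel_zero
  | succ n ih =>
    refine rel_of_relRad (Nat.succ_pos n) ?_
    rcases Nat.eq_zero_or_pos n with rfl | hn
    · exact relRad_one
    intro I J t S u v hr hI hIJ hS hu hun
    obtain ⟨i1, h1⟩ := Finset.card_pos.1 (by omega : 0 < S.card)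
    have : ∀ m, DD I S i1 m := fun m => by
      induction m with
      | zero => exact DD_zero I S i1 h1
      | succ m ihm => exact DD_succ hn ih hr hI hS h1 ihm
    exact this ((v i1).natDegree + 1) J t u v (v i1) hIJ hu hun
      (degree_le_natDegree.trans_lt (by exact_mod_cast Nat.lt_succ_self _)) (by simp)

end rel
end Um3

namespace Um3
section data
variable {A : Type*} [CommRing A] {P : Type*} [AddCommGroup P] [Module A P]

lemma map_smul_top {J : Ideal A} (φ : P →ₗ[A] A) {z : P} (hz : z ∈ J • (⊤ : Submodule A P)) :
    φ z ∈ J := by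
  induction hz using Submodule.smul_induction_on' with
  | smul r hr n hn => rw [map_smul]; exact J.mul_mem_right _ hr
  | add x hx y hy h1 h2 => rw [map_add]; exact J.add_mem h1 h2

lemma extract_data [Module.Finite A P] [Module.Projective A P] (J : Ideal A) (x : A)
    (hx : ∀ y, x * y ∈ J → y ∈ J)
    (hfree : Module.Free (Localization (Submonoid.powers (Ideal.Quotient.mk J x)))
      (LocalizedModule (Submonoid.powers (Ideal.Quotient.mk J x))
        (P ⧸ (J • ⊤ : Submodule A P)))) :
    ∃ (N n : ℕ) (pp : Fin n → P) (φ : Fin n → P →ₗ[A] A),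
      (∀ q, x ^ N • q - ∑ i, φ i q • pp i ∈ (J • ⊤ : Submodule A P)) ∧
      ∀ i j, φ i (pp j) - (if i = j then x ^ N else 0) ∈ J := by
  classical
  obtain ⟨m, f, s, -, -, hfs⟩ := Module.Finite.exists_comp_eq_id_of_projective A P
  -- coordinates
  let ξ : Fin m → P →ₗ[A] A := fun k => LinearMap.proj k ∘ₗ s
  let e : Fin m → P := fun k => f (Pi.single k 1)
  have hsum : ∀ q, q = ∑ k, ξ k q • e k := by
    intro q
    have h1 : f (s q) = q := LinearMap.congr_fun hfs q
    conv_lhs => rw [← h1]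
    have h2 : s q = ∑ k, s q k • (Pi.single k 1 : Fin m → A) := by
      rw [← pi_eq_sum_univ']
    conv_lhs => rw [h2]
    rw [map_sum]
    simp [ξ, e]
  have hxk : ∀ (k : ℕ) y, x ^ k * y ∈ J → y ∈ J := by
    intro k
    induction k with
    | zero => intro y hy; simpa using hy
    | succ k ih => intro y hy; rw [pow_succ, mul_assoc] at hy; exact hx y (ih _ hy)
  have hxP : ∀ (k : ℕ) (z : P), x ^ k • z ∈ (J • ⊤ : Submodule A P) → z ∈ (J • ⊤ : Submodule A P) := by
    intro k z hz
    rw [hsum z]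
    refine Submodule.sum_mem _ (fun i _ => Submodule.smul_mem_smul (hxk k _ ?_) trivial)
    have := map_smul_top (ξ i) hz
    rwa [map_smul, smul_eq_mul] at this
  set x' := Ideal.Quotient.mk J x with hx'
  set W := Submonoid.powers x' with hW
  set Bx := Localization W
  set Q := P ⧸ (J • ⊤ : Submodule A P)
  set Mx := LocalizedModule W Q
  let ℓ : Q →ₗ[A ⧸ J] Mx := LocalizedModule.mkLinearMap W Q
  let b0 := Module.Free.chooseBasis Bx Mx
  let n := Fintype.card (Module.Free.ChooseBasisIndex Bx Mx)
  let b1 : Module.Basis (Fin n) Bx Mx := b0.reindex (Fintype.equivFin _)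
  have hs : ∀ i, ∃ y : Q × W, y.2 • b1 i = ℓ y.1 := fun i => IsLocalizedModule.surj W ℓ (b1 i)
  choose y hy using hs
  have hu : ∀ i, IsUnit (algebraMap (A ⧸ J) Bx (y i).2) := fun i =>
    IsLocalization.map_units Bx (y i).2
  let b := b1.isUnitSMul hu
  have hb : ∀ i, b i = ℓ (y i).1 := by
    intro i
    rw [← hy i, Module.Basis.isUnitSMul_apply]
    rw [algebraMap_smul]; rfl
  have hpp : ∀ i, ∃ p : P, (Submodule.Quotient.mk p : Q) = (y i).1 := fun i =>
    Submodule.Quotient.mk_surjective _ _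
  choose pp hpp using hpp
  let lq : P → Mx := fun q => ℓ (Submodule.Quotient.mk q)
  have hlq : ∀ (a : A) q, lq (a • q) = algebraMap (A ⧸ J) Bx (Ideal.Quotient.mk J a) • lq q := by
    intro a q
    rw [algebraMap_smul]
    simp only [lq]
    rw [← map_smul]; rfl
  have hlqa : ∀ (p q : P), lq (p + q) = lq p + lq q := fun p q => by
    simp only [lq, Submodule.Quotient.mk_add, map_add]
  have hlqs : ∀ {κ : Type} (T : Finset κ) (g : κ → P), lq (∑ i ∈ T, g i) = ∑ i ∈ T, lq (g i) := by
    intro κ T g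
    induction T using Finset.induction_on with
    | empty => simp [lq]
    | insert k T hk ih => rw [Finset.sum_insert hk, Finset.sum_insert hk, hlqa, ih]
  have hlqz : ∀ q, lq q = 0 → q ∈ (J • ⊤ : Submodule A P) := by
    intro q hq
    obtain ⟨⟨_, k, rfl⟩, hk⟩ := (IsLocalizedModule.eq_zero_iff W ℓ).1 hq
    apply hxP k
    rw [← Submodule.Quotient.mk_eq_zero]
    have hk' : (Ideal.Quotient.mk J x ^ k) • (Submodule.Quotient.mk q : Q) = 0 := hk
    have h0 : (Submodule.Quotient.mk (x ^ k • q) : Q) =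
      Ideal.Quotient.mk J (x ^ k) • (Submodule.Quotient.mk q : Q) := rfl
    rw [h0, map_pow, hk']
  have hbx : ∀ a : A, algebraMap (A ⧸ J) Bx (Ideal.Quotient.mk J a) = 0 → a ∈ J := by
    intro a ha
    obtain ⟨⟨_, k, rfl⟩, hk⟩ := (IsLocalization.map_eq_zero_iff W Bx _).1 ha
    apply hxk k
    rw [← Ideal.Quotient.eq_zero_iff_mem, map_mul, map_pow]
    exact hk
  obtain ⟨⟨_, K, rfl⟩, hK⟩ := IsLocalization.exist_integer_multiples_of_finite W
    (fun ik : Fin n × Fin m => b.repr (lq (e ik.2)) ik.1)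
  have hK' : ∀ i k, ∃ a : A, algebraMap (A ⧸ J) Bx (Ideal.Quotient.mk J a) =
      algebraMap (A ⧸ J) Bx (Ideal.Quotient.mk J x) ^ K * b.repr (lq (e k)) i := by
    intro i k
    obtain ⟨a, ha⟩ := hK (i, k)
    obtain ⟨a, rfl⟩ := Ideal.Quotient.mk_surjective a
    refine ⟨a, ha.trans ?_⟩
    simp only
    rw [← algebraMap_smul Bx, smul_eq_mul, map_pow]
  choose c hc using hK'
  let φ : Fin n → P →ₗ[A] A := fun i => ∑ k, c i k • ξ k
  have hφ : ∀ i q, algebraMap (A ⧸ J) Bx (Ideal.Quotient.mk J (φ i q)) =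
      algebraMap (A ⧸ J) Bx (Ideal.Quotient.mk J x) ^ K * b.repr (lq q) i := by
    intro i q
    conv_rhs => rw [hsum q]
    rw [hlqs, map_sum, Finsupp.finsetSum_apply, Finset.mul_sum]
    simp only [φ, LinearMap.sum_apply, LinearMap.smul_apply, map_sum, smul_eq_mul, map_mul, hlq, map_smul,
      Finsupp.smul_apply, hc]
    refine Finset.sum_congr rfl (fun k _ => by ring)
  refine ⟨K, n, pp, φ, fun q => ?_, fun i j => ?_⟩
  · apply hlqz
    have h1 : lq (x ^ K • q) = ∑ i, lq (φ i q • pp i) := by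
      rw [hlq, map_pow, map_pow]
      conv_lhs => rw [← b.sum_repr (lq q)]
      rw [Finset.smul_sum]
      refine Finset.sum_congr rfl (fun i _ => ?_)
      rw [hlq, hφ, ← smul_smul, hb, ← hpp]
    rw [← hlqs] at h1
    simp only [lq, Submodule.Quotient.mk_sub, map_sub] at h1 ⊢
    rw [h1, sub_self]
  · apply hbx
    have h1 : lq (pp j) = b j := by rw [hb, ← hpp]
    rw [map_sub, map_sub, hφ, h1, b.repr_self, Finsupp.single_apply]
    by_cases hij : i = j
    · subst hij; simp
    · rw [if_neg hij, if_neg (Ne.symm hij)]; simp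

lemma rank_le (J : Ideal A) (x : A) (N n r : ℕ) (pp : Fin n → P) (φ : Fin n → P →ₗ[A] A)
    [Module.Finite A P]
    (h : ∀ q, x ^ N • q - ∑ i, φ i q • pp i ∈ (J • ⊤ : Submodule A P))
    (hr : HasConstantRank A P r) (M : Ideal A) (hM : M.IsPrime) (hJM : J ≤ M) (hxM : x ∉ M) :
    r ≤ n := by
  obtain ⟨-, h2⟩ := hr M hM
  set Ap := Localization.AtPrime M
  set Pp := LocalizedModule M.primeCompl P
  let ℓ : P →ₗ[A] Pp := LocalizedModule.mkLinearMap M.primeCompl P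
  have htop : Submodule.span Ap (Set.range (fun i => ℓ (pp i))) = ⊤ := by
    rw [eq_top_iff]
    refine Submodule.le_of_le_smul_of_le_jacobson_bot (I := IsLocalRing.maximalIdeal Ap)
      Module.Finite.fg_top (IsLocalRing.maximalIdeal_le_jacobson _) ?_
    intro z _
    obtain ⟨⟨q, s⟩, hq⟩ := IsLocalizedModule.surj M.primeCompl ℓ z
    have hxN : x ^ N ∈ M.primeCompl := fun hh => hxM (hM.mem_of_pow_mem N hh)
    have hu : IsUnit (algebraMap A Ap (x ^ N * s)) :=
      IsLocalization.map_units Ap (⟨x ^ N, hxN⟩ * s : M.primeCompl)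
    rw [← Submodule.smul_mem_iff_of_isUnit _ hu, map_mul, ← smul_smul, algebraMap_smul, algebraMap_smul]
    have hq' : (s : A) • z = ℓ q := hq
    rw [hq', ← map_smul]
    have e : x ^ N • q = ∑ i, φ i q • pp i + (x ^ N • q - ∑ i, φ i q • pp i) := by abel
    rw [e, map_add]
    refine Submodule.add_mem _ (Submodule.mem_sup_left ?_) (Submodule.mem_sup_right ?_)
    · rw [map_sum]
      refine Submodule.sum_mem _ (fun i _ => ?_)
      rw [map_smul, ← algebraMap_smul Ap]
      exact Submodule.smul_mem _ _ (Submodule.subset_span ⟨i, rfl⟩)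
    · have := h q
      generalize x ^ N • q - ∑ i, φ i q • pp i = w at this
      induction this using Submodule.smul_induction_on' with
      | smul a ha y hy =>
        have e1 : ℓ (a • y) = algebraMap A Ap a • ℓ y := by rw [map_smul, algebraMap_smul]
        rw [e1]
        refine Submodule.smul_mem_smul ?_ Submodule.mem_top
        exact (IsLocalization.AtPrime.to_map_mem_maximal_iff Ap M a).2 (hJM ha)
      | add x hx y hy h1 h2 => rw [map_add]; exact Submodule.add_mem _ h1 h2
  have h3 := finrank_range_le_card (R := Ap) (fun i => ℓ (pp i))
  rw [Set.finrank, htop, finrank_top, h2, Fintype.card_fin] at h3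
  exact h3

end data
end Um3

namespace Um3
section trans
variable {A : Type*} [CommRing A] {P : Type*} [AddCommGroup P] [Module A P]

def Tr (v w : A × P) : Prop := ∃ σ ∈ TransvectionGroup A (A × P), σ v = w

lemma Tr.refl (v : A × P) : Tr v v := ⟨1, one_mem _, rfl⟩

lemma Tr.trans {u v w : A × P} (h : Tr u v) (h' : Tr v w) : Tr u w := by
  obtain ⟨σ, hσ, rfl⟩ := h
  obtain ⟨τ, hτ, rfl⟩ := h'
  exact ⟨τ * σ, mul_mem hτ hσ, rfl⟩

lemma Tr.symm {v w : A × P} (h : Tr v w) : Tr w v := by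
  obtain ⟨σ, hσ, rfl⟩ := h
  exact ⟨σ⁻¹, inv_mem hσ, σ.symm_apply_apply v⟩

lemma tr_basic (p : A × P) (φ : (A × P) →ₗ[A] A) (h : φ p = 0)
    (hu : IsUnimodular A (A × P) p ∨ IsUnimodular A ((A × P) →ₗ[A] A) φ) (v : A × P) :
    Tr v (v + φ v • p) := by
  refine ⟨LinearEquiv.transvection h, Subgroup.subset_closure ⟨p, φ, h, hu, fun q => ?_⟩, ?_⟩
  · exact LinearEquiv.transvection.apply h q
  · exact LinearEquiv.transvection.apply h v

lemma tr_down (α : A) (p q : P) : Tr (α, p) (α, p + α • q) := by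
  have := tr_basic (0, q) (LinearMap.fst A A P) (by simp)
    (Or.inr ⟨LinearMap.applyₗ (1, 0), by simp⟩) (α, p)
  simpa using this

lemma tr_up (α : A) (p : P) (φ : P →ₗ[A] A) : Tr (α, p) (α + φ p, p) := by
  have := tr_basic (1, 0) (φ ∘ₗ LinearMap.snd A A P) (by simp)
    (Or.inl ⟨LinearMap.fst A A P, by simp⟩) (α, p)
  simpa using this

lemma lift_step {n : ℕ} (J : Ideal A) (T : A) (pp : Fin n → P) (φ : Fin n → P →ₗ[A] A)
    (h2 : ∀ i j, φ i (pp j) - (if i = j then T else 0) ∈ J)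
    {x y : A × (Fin n → A)} (h : EStep ⊤ (Ideal.span {T}) Finset.univ x y)
    (α : A) (p : P) (h3 : α - x.1 ∈ J) (h4 : p - ∑ i, x.2 i • pp i ∈ (J • ⊤ : Submodule A P)) :
    ∃ α' p', Tr (α, p) (α', p') ∧ α' - y.1 ∈ J ∧
      p' - ∑ i, y.2 i • pp i ∈ (J • ⊤ : Submodule A P) := by
  cases h with
  | addv u v i c hi hc =>
    refine ⟨α, _, tr_down α p (c • pp i), h3, ?_⟩
    simp only at h3 h4 ⊢
    have e : ∑ j, Function.update v i (v i + c * u) j • pp j = ∑ j, v j • pp j + (c * u) • pp i := by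
      rw [← Finset.add_sum_erase _ _ (Finset.mem_univ i), ← Finset.add_sum_erase _ (fun j => v j • pp j) (Finset.mem_univ i)]
      rw [Function.update_self, add_smul]
      have : ∑ j ∈ Finset.univ.erase i, Function.update v i (v i + c * u) j • pp j
        = ∑ j ∈ Finset.univ.erase i, v j • pp j := by
        refine Finset.sum_congr rfl (fun j hj => ?_)
        rw [Function.update_of_ne (Finset.ne_of_mem_erase hj)]
      rw [this]; abel
    have e2 : p + α • c • pp i - ∑ j, Function.update v i (v i + c * u) j • pp j
        = (p - ∑ j, v j • pp j) + (α - u) • c • pp i := by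
      rw [e, sub_smul, smul_smul, smul_smul, mul_comm u c]; abel
    rw [e2]
    exact Submodule.add_mem _ h4 (Submodule.smul_mem_smul h3 trivial)
  | addu u v i c hi hc =>
    obtain ⟨c', rfl⟩ := Ideal.mem_span_singleton'.1 hc
    refine ⟨_, p, tr_up α p (c' • φ i), ?_, h4⟩
    simp only at h3 h4 ⊢
    have h5 := map_smul_top (φ i) h4
    have h6 : ∑ j, v j * (φ i (pp j) - (if i = j then T else 0)) ∈ J :=
      J.sum_mem (fun j _ => J.mul_mem_left _ (h2 i j))
    have e : α + (c' • φ i) p - (u + c' * T * v i) = (α - u) + c' * (φ i (p - ∑ j, v j • pp j)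
        + ∑ j, v j * (φ i (pp j) - (if i = j then T else 0))) := by
      simp [mul_sub, Finset.sum_sub_distrib]
      ring
    rw [e]
    exact J.add_mem h3 (J.mul_mem_left _ (J.add_mem h5 h6))

lemma lift_reach {n : ℕ} (J : Ideal A) (T : A) (pp : Fin n → P) (φ : Fin n → P →ₗ[A] A)
    (h2 : ∀ i j, φ i (pp j) - (if i = j then T else 0) ∈ J)
    {x y : A × (Fin n → A)} (h : EReach ⊤ (Ideal.span {T}) Finset.univ x y)
    (α : A) (p : P) (h3 : α - x.1 ∈ J) (h4 : p - ∑ i, x.2 i • pp i ∈ (J • ⊤ : Submodule A P)) :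
    ∃ α' p', Tr (α, p) (α', p') ∧ α' - y.1 ∈ J ∧
      p' - ∑ i, y.2 i • pp i ∈ (J • ⊤ : Submodule A P) := by
  induction h with
  | refl => exact ⟨α, p, Tr.refl _, h3, h4⟩
  | tail _ h ih =>
    obtain ⟨α', p', a1, a2, a3⟩ := ih
    obtain ⟨α'', p'', b1, b2, b3⟩ := lift_step J T pp φ h2 h α' p' a2 a3
    exact ⟨α'', p'', a1.trans b1, b2, b3⟩

end trans

section claim
variable {R : Type*} [CommRing R] {P : Type*} [AddCommGroup P] [Module R[X] P]
    [Module.Finite R[X] P] [Module.Projective R[X] P]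

lemma claim (r : ℕ) (hrank : HasConstantRank R[X] P r) (hΩ : PropertyOmega R R[X] P) (n : ℕ) :
    ∀ I : Ideal R, KD I n → n ≤ r → ∀ x : R[X] × P,
      (∃ ψ : (R[X] × P) →ₗ[R[X]] R[X], ψ x - 1 ∈ I.map C) →
      ∃ α' p', Tr x (α', p') ∧ α' - 1 ∈ I.map C ∧ p' ∈ (I.map C • ⊤ : Submodule R[X] P) := by
  have htop : ∀ I : Ideal R, I = ⊤ → ∀ x : R[X] × P,
      ∃ α' p', Tr x (α', p') ∧ α' - 1 ∈ I.map C ∧ p' ∈ (I.map C • ⊤ : Submodule R[X] P) := by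
    rintro I rfl ⟨α, p⟩
    exact ⟨α, p, Tr.refl _, by simp [Ideal.map_top], by simp [Ideal.map_top]⟩
  induction n with
  | zero => intro I hI _ x _; exact htop I hI.zero x
  | succ n ih =>
    intro I hI hn x hx
    by_cases hIt : I = ⊤
    · exact htop I hIt x
    obtain ⟨t, ht, hfree⟩ := hΩ I
    have ht' : ∀ s, s * t ∈ I → s ∈ I := by
      intro s hs
      rw [← Ideal.Quotient.eq_zero_iff_mem] at hs ⊢
      rw [map_mul] at hs
      exact (mem_nonZeroDivisors_iff.1 ht).2 _ hs
    have htA : ∀ y : R[X], C t * y ∈ I.map C → y ∈ I.map C := by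
      intro y hy
      rw [Ideal.mem_map_C_iff] at hy ⊢
      intro k
      apply ht'
      have := hy k
      rwa [coeff_C_mul, mul_comm] at this
    obtain ⟨N, m, pp, φ, h1, h2⟩ := extract_data (P := P) (I.map C) (C t) htA hfree
    have hrm : r ≤ m := by
      have hdis : Disjoint (I : Set R) (Submonoid.powers t) := by
        rw [Set.disjoint_left]
        rintro a ha ⟨k, rfl⟩
        apply hIt
        rw [Ideal.eq_top_iff_one]
        have : ∀ k, t ^ k ∈ I → (1 : R) ∈ I := by
          intro k
          induction k with
          | zero => simp
          | succ k ih => intro h; exact ih (ht' _ (by rwa [← pow_succ]))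
        exact this k ha
      obtain ⟨p0, hp0, hIp, hdp⟩ := Ideal.exists_le_prime_disjoint I _ hdis
      refine rank_le (I.map C) (C t) N m r pp φ h1 hrank (p0.comap (evalRingHom 0)) inferInstance ?_ ?_
      · rw [Ideal.map_le_iff_le_comap]
        intro a ha
        simpa using hIp ha
      · simp only [Ideal.mem_comap, coe_evalRingHom, eval_C]
        intro h
        exact Set.disjoint_left.1 hdp h (Submonoid.mem_powers t)
    have hle : I.map C ≤ (I ⊔ Ideal.span {t ^ N}).map (C : R →+* R[X]) := Ideal.map_mono le_sup_left
    obtain ⟨ψ, hψ⟩ := hx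
    obtain ⟨α, p, ⟨σ, hσ, hσx⟩, hα, hp⟩ := ih _ (hI.step2 t ht' N) (by omega) x ⟨ψ, hle hψ⟩
    have hmap : (Ideal.span {t ^ N}).map (C : R →+* R[X]) = Ideal.span {C t ^ N} := by
      rw [Ideal.map_span, Set.image_singleton, map_pow]
    rw [Ideal.map_sup, hmap] at hα hp
    rw [Submodule.sup_smul, Submodule.mem_sup] at hp
    obtain ⟨p1, hp1, p2, hp2, rfl⟩ := hp
    rw [Submodule.ideal_span_singleton_smul] at hp2
    obtain ⟨p', -, rfl⟩ := hp2
    set p := p1 + C t ^ N • p' with hpdef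
    let f : Fin m → R[X] := fun i => φ i p'
    have hpf : p - ∑ i, f i • pp i ∈ (I.map C • ⊤ : Submodule R[X] P) := by
      have e : p - ∑ i, f i • pp i = p1 + (C t ^ N • p' - ∑ i, φ i p' • pp i) := by
        simp only [hpdef, f]; abel
      rw [e]
      exact Submodule.add_mem _ hp1 (h1 p')
    have hun : Un (I.map C) (Finset.univ : Finset (Fin m)) (α, f) := by
      intro M hM hJM hαM
      by_contra hcon
      push Not at hcon
      let ψ' : (R[X] × P) →ₗ[R[X]] R[X] := ψ ∘ₗ (σ.symm : (R[X] × P) →ₗ[R[X]] (R[X] × P))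
      have e1 : ψ' (α, p) = ψ x := by
        simp only [ψ', LinearMap.comp_apply]
        congr 1
        exact (LinearEquiv.symm_apply_eq σ).2 hσx.symm
      have hpM : p ∈ (M • ⊤ : Submodule R[X] P) := by
        have := Submodule.smul_mono_left hJM hpf
        have e : p = (p - ∑ i, f i • pp i) + ∑ i, f i • pp i := by abel
        rw [e]
        exact Submodule.add_mem _ this (Submodule.sum_mem _ fun i hi =>
          Submodule.smul_mem_smul (hcon i hi) trivial)
      have e2 : ψ' (α, p) = α * ψ' (1, 0) + (ψ' ∘ₗ LinearMap.inr R[X] R[X] P) p := by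
        have : ((α, p) : R[X] × P) = α • (1, 0) + (0, p) := by simp
        rw [this, map_add, map_smul]; rfl
      have e3 : ψ' (α, p) ∈ M := by
        rw [e2]
        exact M.add_mem (M.mul_mem_right _ hαM) (map_smul_top _ hpM)
      rw [e1] at e3
      exact not_mem_of_cong hM (hJM hψ) e3
    have hre := rel_all (R := R) (ι := Fin m) m I (I.map C) (Ideal.span {t ^ N}) Finset.univ α f
      (hI.mono (hn.trans hrm) le_rfl) le_rfl (by simp) (by rw [hmap, sup_comm]; exact hα) hun
    obtain ⟨z, hz, hc⟩ := hre.extract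
    rw [hmap] at hz
    obtain ⟨α', p'', g1, g2, g3⟩ := lift_reach (I.map C) (C t ^ N) pp φ h2 hz α p (by simp) hpf
    refine ⟨α', p'', Tr.trans ⟨σ, hσ, hσx⟩ g1, ?_, ?_⟩
    · have := Ideal.sub_mem _ g2 hc.1
      simpa using this
    · have e : p'' = (p'' - ∑ i, z.2 i • pp i) + ∑ i, z.2 i • pp i := by abel
      rw [e]
      refine Submodule.add_mem _ g3 (Submodule.sum_mem _ fun i hi =>
          Submodule.smul_mem_smul ?_ trivial)
      have := hc.2 i hi
      simpa using this

end claim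
end Um3

/-- Let `R` be a commutative ring of finite Krull dimension `d` and
`A = R[Y]` the polynomial ring in one variable. If `P` is a finitely generated projective
`A`-module of constant rank `r ≥ d + 1` satisfying property `Ω(R)`, then `E(A ⊕ P)` acts
transitively on `Um(A ⊕ P)`. -/
theorem statement_3 (R : Type*) [CommRing R] (d : ℕ) (hdim : ringKrullDim R = d)
    (P : Type*) [AddCommGroup P] [Module R[X] P]
    [Module.Finite R[X] P] [Module.Projective R[X] P]
    (r : ℕ) (hr : d + 1 ≤ r) (hrank : HasConstantRank R[X] P r)
    (hΩ : PropertyOmega R R[X] P) :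
    ∀ v w : R[X] × P, IsUnimodular R[X] (R[X] × P) v → IsUnimodular R[X] (R[X] × P) w →
      ∃ σ ∈ TransvectionGroup R[X] (R[X] × P), σ v = w := by
  have key : ∀ v : R[X] × P, IsUnimodular R[X] (R[X] × P) v → Um3.Tr v (1, 0) := by
    rintro v ⟨ψ, hψ⟩
    obtain ⟨α, p, h, h1, h2⟩ := Um3.claim r hrank hΩ (d + 1) ⊥ (Um3.KD.bot hdim) hr v
      ⟨ψ, by rw [hψ, sub_self]; exact zero_mem _⟩
    rw [Ideal.map_bot] at h1 h2
    rw [Submodule.bot_smul, Submodule.mem_bot] at h2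
    rw [Ideal.mem_bot, sub_eq_zero] at h1
    rw [h1, h2] at h
    exact h
  intro v w hv hw
  exact (key v hv).trans (key w hw).symm
end
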